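/- arXiv:2512.16539 — 2 statements merged into one kernel-verified Lean document; each statement's English description precedes it below -/
import Mathlib

section
/- Let A ∈ ℂ^{n×n} be a negative definite Hermitian matrix, p ≤ n, and μ > |λ_min(A)|. Let Q_p ∈ ℂ^{n×p} have orthonormal columns that are eigenvectors of A corresponding to the p smallest eigenvalues counted with multiplicity (A Q_p = Q_p Λ_p), set Λ̄_p = (tr(Λ_p)/p) I, and let V ∈ ℂ^{p×p} be any unitary matrix such that X = Q_p (I − (Λ_p − Λ̄_p)/μ)^{1/2} V^* lies in OB(n,p) (such V exists). Then X is a global minimizer of g_μ over OB(n,p), with g_μ(X) = (μ/4) tr((I + Λ̄_p/μ)^2 − Λ_p^2/μ^2), and g_μ(Y) ≥ g_μ(X) for every Y ∈ OB(n,p). In particular, every local minimum of g_μ over OB(n,p) equals this global minimum. -/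
open Matrix Finset

noncomputable section

/-- The oblique manifold `OB(n,p)`: complex `n × p` matrices all of whose columns have
unit norm, i.e. every diagonal entry of `Xᴴ * X` equals `1`. -/
def OBset (n p : ℕ) : Set (Matrix (Fin n) (Fin p) ℂ) :=
  {X | ∀ j, (Xᴴ * X) j j = 1}

/-- Frobenius norm of a complex matrix. -/
def frobNorm {n p : ℕ} (X : Matrix (Fin n) (Fin p) ℂ) : ℝ :=
  Real.sqrt (∑ i, ∑ j, Complex.normSq (X i j))

/-- The eigenvalues of a Hermitian matrix, listed in nondecreasing order
(counted with multiplicity). -/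
def sortedEig {n : ℕ} {A : Matrix (Fin n) (Fin n) ℂ} (hA : A.IsHermitian) : Fin n → ℝ :=
  fun i => hA.eigenvalues (Tuple.sort hA.eigenvalues i)

/-- The qTPM objective `g_μ(X) = (1/2) tr(X*AX) + (μ/4) tr((X*X)(X*X))`. -/
def gmu {n p : ℕ} (A : Matrix (Fin n) (Fin n) ℂ) (μ : ℝ)
    (X : Matrix (Fin n) (Fin p) ℂ) : ℝ :=
  (1 / 2) * (Xᴴ * A * X).trace.re + (μ / 4) * ((Xᴴ * X) * (Xᴴ * X)).trace.re

/-- The candidate qTPM minimizer `Q_p (I − (Λ_p − Λ̄_p)/μ)^{1/2} V^*`. -/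
def qtpmPoint {n p : ℕ} (hpn : p ≤ n) {A : Matrix (Fin n) (Fin n) ℂ}
    (hA : A.IsHermitian) (μ : ℝ) (Q : Matrix (Fin n) (Fin p) ℂ)
    (V : Matrix (Fin p) (Fin p) ℂ) : Matrix (Fin n) (Fin p) ℂ :=
  Q * Matrix.diagonal (fun j : Fin p =>
    (Real.sqrt (1 - (sortedEig hA (Fin.castLE hpn j)
      - (∑ l : Fin p, sortedEig hA (Fin.castLE hpn l)) / p) / μ) : ℂ)) * Vᴴ

/-- `f` has second-order expansion `a + t b + t² c + O(t³)` along the real line, with a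
continuous cubic remainder coefficient. -/
def HasQuadraticExpansion {R : Type*} [AddCommGroup R] [Module ℝ R] [TopologicalSpace R]
    (f : ℝ → R) (a b c : R) : Prop :=
  ∃ h : ℝ → R, Continuous h ∧ ∀ t, f t = a + t • b + t ^ 2 • c + t ^ 3 • h t

lemma HasQuadraticExpansion.mul {R : Type*} [Ring R] [Algebra ℝ R] [TopologicalSpace R]
    [IsTopologicalRing R] [ContinuousSMul ℝ R] {f g : ℝ → R} {a b c a' b' c' : R}
    (hf : HasQuadraticExpansion f a b c) (hg : HasQuadraticExpansion g a' b' c') :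
    HasQuadraticExpansion (fun t => f t * g t) (a * a') (a * b' + b * a')
      (a * c' + b * b' + c * a') := by
  obtain ⟨h, hc, hh⟩ := hf
  obtain ⟨k, kc, hk⟩ := hg
  refine ⟨fun t => b * c' + c * b' + t • (c * c') + (a + t • b + t ^ 2 • c) * k t
    + h t * (a' + t • b' + t ^ 2 • c') + t ^ 3 • (h t * k t), by fun_prop, fun t => ?_⟩
  simp only [hh, hk, mul_add, add_mul, smul_add, mul_smul_comm, smul_mul_assoc]
  module

lemma HasQuadraticExpansion.quadratic {R : Type*} [AddCommGroup R] [Module ℝ R]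
    [TopologicalSpace R] {f : ℝ → R} {a b c : R} (hf : ∀ t, f t = a + t • b + t ^ 2 • c) :
    HasQuadraticExpansion f a b c :=
  ⟨fun _ => 0, continuous_const, fun t => by simp [hf]⟩

lemma HasQuadraticExpansion.linear_eq_zero_and_quadratic_nonneg {f : ℝ → ℝ} {a b c : ℝ}
    (hf : HasQuadraticExpansion f a b c) (hmin : ∀ᶠ t in nhds 0, f 0 ≤ f t) :
    b = 0 ∧ 0 ≤ c := by
  obtain ⟨h, hc, hh⟩ := hf
  have key : ∀ᶠ t in nhds (0 : ℝ), 0 ≤ t * (b + t * c + t ^ 2 * h t) := by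
    filter_upwards [hmin] with t ht
    rw [hh, hh t] at ht
    simp only [smul_eq_mul] at ht
    linarith
  have hlim : Filter.Tendsto (fun t : ℝ => b + t * c + t ^ 2 * h t) (nhds 0) (nhds b) := by
    have : Continuous (fun t : ℝ => b + t * c + t ^ 2 * h t) := by fun_prop
    simpa using this.tendsto 0
  have hb : b = 0 := by
    apply le_antisymm
    · refine le_of_tendsto (hlim.mono_left (nhdsWithin_le_nhds (s := Set.Iio 0))) ?_
      filter_upwards [nhdsWithin_le_nhds key, self_mem_nhdsWithin] with t h1 h2
      exact nonpos_of_mul_nonneg_right h1 h2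
    · refine ge_of_tendsto (hlim.mono_left (nhdsWithin_le_nhds (s := Set.Ioi 0))) ?_
      filter_upwards [nhdsWithin_le_nhds key, self_mem_nhdsWithin] with t h1 h2
      exact nonneg_of_mul_nonneg_right h1 h2
  refine ⟨hb, ?_⟩
  subst hb
  have hlim2 : Filter.Tendsto (fun t : ℝ => c + t * h t) (nhds 0) (nhds c) := by
    have : Continuous (fun t : ℝ => c + t * h t) := by fun_prop
    simpa using this.tendsto 0
  refine ge_of_tendsto (hlim2.mono_left (nhdsWithin_le_nhds (s := Set.Ioi 0))) ?_
  filter_upwards [nhdsWithin_le_nhds key, self_mem_nhdsWithin] with t h1 h2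
  have h2' : (0 : ℝ) < t ^ 2 := pow_pos h2 2
  refine nonneg_of_mul_nonneg_right (a := t ^ 2) ?_ h2'
  linarith

/-- The Frobenius-local minimality of `Z` for `gmu` on the oblique manifold. -/
def IsLocalMinimizer {n p : ℕ} (A : Matrix (Fin n) (Fin n) ℂ) (μ : ℝ)
    (Z : Matrix (Fin n) (Fin p) ℂ) : Prop :=
  ∃ δ > (0 : ℝ), ∀ Y ∈ OBset n p, frobNorm (Y - Z) < δ → gmu A μ Z ≤ gmu A μ Y

lemma continuous_frobNorm {n p : ℕ} :
    Continuous (frobNorm : Matrix (Fin n) (Fin p) ℂ → ℝ) := by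
  unfold frobNorm
  have h : ∀ i j, Continuous fun X : Matrix (Fin n) (Fin p) ℂ => X i j := fun i j => by fun_prop
  refine Real.continuous_sqrt.comp (continuous_finsetSum _ fun i _ => continuous_finsetSum _
    fun j _ => Complex.continuous_normSq.comp (h i j))

/-- The squared column norms of `ξ`. -/
def colNormSq {n p : ℕ} (ξ : Matrix (Fin n) (Fin p) ℂ) (j : Fin p) : ℝ :=
  ∑ i, Complex.normSq (ξ i j)

lemma colNormSq_nonneg {n p : ℕ} (ξ : Matrix (Fin n) (Fin p) ℂ) (j : Fin p) :
    0 ≤ colNormSq ξ j := Finset.sum_nonneg fun _ _ => Complex.normSq_nonneg _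

lemma conjTranspose_mul_self_diag {n p : ℕ} (ξ : Matrix (Fin n) (Fin p) ℂ) (j : Fin p) :
    (ξᴴ * ξ) j j = (colNormSq ξ j : ℂ) := by
  simp [Matrix.mul_apply, colNormSq, Complex.normSq_eq_conj_mul_self]

/-- The squared normalisation factors of the columns of `Z + t ξ`. -/
def normalizer {n p : ℕ} (ξ : Matrix (Fin n) (Fin p) ℂ) (t : ℝ) : Matrix (Fin p) (Fin p) ℂ :=
  Matrix.diagonal fun j => (((1 + t ^ 2 * colNormSq ξ j)⁻¹ : ℝ) : ℂ)

lemma hasQuadraticExpansion_normalizer {n p : ℕ} (ξ : Matrix (Fin n) (Fin p) ℂ) :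
    HasQuadraticExpansion (normalizer ξ) 1 0
      (-Matrix.diagonal fun j => (colNormSq ξ j : ℂ)) := by
  have hpos : ∀ t j, 1 + t ^ 2 * colNormSq ξ j ≠ 0 := fun t j => by
    have := colNormSq_nonneg ξ j
    positivity
  refine ⟨fun t => Matrix.diagonal fun j =>
    ((t * colNormSq ξ j ^ 2 * (1 + t ^ 2 * colNormSq ξ j)⁻¹ : ℝ) : ℂ), ?_, fun t => ?_⟩
  · refine Continuous.matrix_diagonal (continuous_pi fun j => ?_)
    refine Complex.continuous_ofReal.comp (Continuous.mul (by fun_prop) ?_)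
    exact Continuous.inv₀ (by fun_prop) fun t => hpos t j
  · ext j k
    rcases eq_or_ne j k with rfl | hjk
    · simp only [normalizer, Matrix.diagonal_apply_eq, Matrix.add_apply, Matrix.smul_apply,
        Matrix.one_apply_eq, Matrix.neg_apply, Matrix.zero_apply, Complex.real_smul]
      have h : ((1 + t ^ 2 * colNormSq ξ j : ℝ) : ℂ) ≠ 0 := by exact_mod_cast hpos t j
      push_cast at h ⊢
      field_simp
      ring
    · simp [normalizer, hjk]

/-- The column-normalised curve through `Z` in the direction `ξ`. -/
def normalizedCurve {n p : ℕ} (Z ξ : Matrix (Fin n) (Fin p) ℂ) (t : ℝ) :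
    Matrix (Fin n) (Fin p) ℂ :=
  (Z + t • ξ) * Matrix.diagonal fun j => ((Real.sqrt (1 + t ^ 2 * colNormSq ξ j)⁻¹ : ℝ) : ℂ)

lemma gmu_normalizedCurve {n p : ℕ} (A : Matrix (Fin n) (Fin n) ℂ) (μ : ℝ)
    (Z ξ : Matrix (Fin n) (Fin p) ℂ) (t : ℝ) :
    gmu A μ (normalizedCurve Z ξ t) =
      (1 / 2) * (normalizer ξ t * ((Z + t • ξ)ᴴ * A * (Z + t • ξ))).trace.re +
      (μ / 4) * ((normalizer ξ t * ((Z + t • ξ)ᴴ * (Z + t • ξ))) *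
        (normalizer ξ t * ((Z + t • ξ)ᴴ * (Z + t • ξ)))).trace.re := by
  set W := Z + t • ξ
  set N : Matrix (Fin p) (Fin p) ℂ :=
    Matrix.diagonal fun j => ((Real.sqrt (1 + t ^ 2 * colNormSq ξ j)⁻¹ : ℝ) : ℂ) with hN
  have hNN : N * N = normalizer ξ t := by
    rw [hN, Matrix.diagonal_mul_diagonal, normalizer]
    congr 1
    funext j
    have := colNormSq_nonneg ξ j
    rw [← Complex.ofReal_mul, Real.mul_self_sqrt (by positivity)]
  have hNH : Nᴴ = N := by
    rw [hN, Matrix.diagonal_conjTranspose]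
    congr 1
    funext j
    simp
  have hY : normalizedCurve Z ξ t = W * N := rfl
  rw [gmu, hY, ← hNN, Matrix.conjTranspose_mul, hNH]
  have h1 : (N * Wᴴ * A * (W * N)).trace = (N * N * (Wᴴ * A * W)).trace := by
    rw [← Matrix.mul_assoc, Matrix.trace_mul_comm]
    simp only [Matrix.mul_assoc]
  have h2 : (N * Wᴴ * (W * N) * (N * Wᴴ * (W * N))).trace =
      (N * N * (Wᴴ * W) * (N * N * (Wᴴ * W))).trace := by
    rw [← Matrix.mul_assoc, ← Matrix.mul_assoc, ← Matrix.mul_assoc, Matrix.trace_mul_comm]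
    simp only [Matrix.mul_assoc]
  rw [h1, h2]

lemma normalizedCurve_mem {n p : ℕ} {Z ξ : Matrix (Fin n) (Fin p) ℂ} (hZ : Z ∈ OBset n p)
    (hξ : ∀ j, (Zᴴ * ξ) j j = 0) (t : ℝ) : normalizedCurve Z ξ t ∈ OBset n p := by
  intro j
  have hξ' : (ξᴴ * Z) j j = 0 := by
    have := congrArg star (hξ j)
    rwa [← Matrix.conjTranspose_apply, Matrix.conjTranspose_mul,
      Matrix.conjTranspose_conjTranspose, star_zero] at this
  have hW : ((Z + t • ξ)ᴴ * (Z + t • ξ)) j j = ((1 + t ^ 2 * colNormSq ξ j : ℝ) : ℂ) := by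
    simp only [Matrix.conjTranspose_add, Matrix.conjTranspose_smul, star_trivial,
      Matrix.add_mul, Matrix.mul_add, Matrix.smul_mul, Matrix.mul_smul, Matrix.add_apply,
      Matrix.smul_apply, hξ, hξ', hZ j, conjTranspose_mul_self_diag]
    simp
    ring
  have hc := colNormSq_nonneg ξ j
  have hp : 0 < 1 + t ^ 2 * colNormSq ξ j := by positivity
  rw [normalizedCurve, Matrix.conjTranspose_mul, Matrix.mul_assoc, ← Matrix.mul_assoc _ _
    (Matrix.diagonal _), Matrix.diagonal_conjTranspose, Matrix.diagonal_mul,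
    Matrix.mul_diagonal, hW, Pi.star_apply, RCLike.star_def, Complex.conj_ofReal]
  norm_cast
  rw [mul_left_comm, Real.mul_self_sqrt (by positivity), mul_inv_cancel₀ hp.ne']

lemma continuous_normalizedCurve {n p : ℕ} (Z ξ : Matrix (Fin n) (Fin p) ℂ) :
    Continuous (normalizedCurve Z ξ) := by
  have hpos : ∀ t j, 1 + t ^ 2 * colNormSq ξ j ≠ 0 := fun t j => by
    have := colNormSq_nonneg ξ j
    positivity
  refine Continuous.matrix_mul (by fun_prop) (Continuous.matrix_diagonal
    (continuous_pi fun j => ?_))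
  exact Complex.continuous_ofReal.comp (Real.continuous_sqrt.comp
    (Continuous.inv₀ (by fun_prop) fun t => hpos t j))

lemma IsLocalMinimizer.eventually_le {n p : ℕ} {A : Matrix (Fin n) (Fin n) ℂ} {μ : ℝ}
    {Z ξ : Matrix (Fin n) (Fin p) ℂ} (hmin : IsLocalMinimizer A μ Z) (hZ : Z ∈ OBset n p)
    (hξ : ∀ j, (Zᴴ * ξ) j j = 0) :
    ∀ᶠ t in nhds (0 : ℝ), gmu A μ (normalizedCurve Z ξ 0) ≤ gmu A μ (normalizedCurve Z ξ t) := by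
  obtain ⟨δ, hδ, h⟩ := hmin
  have h0 : normalizedCurve Z ξ 0 = Z := by simp [normalizedCurve]
  have hc : Continuous fun t => frobNorm (normalizedCurve Z ξ t - Z) :=
    continuous_frobNorm.comp ((continuous_normalizedCurve Z ξ).sub continuous_const)
  have hlt : frobNorm (normalizedCurve Z ξ 0 - Z) < δ := by
    rw [h0, sub_self]
    simpa [frobNorm] using hδ
  filter_upwards [hc.continuousAt.eventually_lt continuousAt_const hlt] with t ht
  rw [h0]
  exact h _ (normalizedCurve_mem hZ hξ t) ht

lemma HasQuadraticExpansion.re_trace {p : ℕ} {f : ℝ → Matrix (Fin p) (Fin p) ℂ}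
    {a b c : Matrix (Fin p) (Fin p) ℂ} (hf : HasQuadraticExpansion f a b c) :
    HasQuadraticExpansion (fun t => (f t).trace.re) a.trace.re b.trace.re c.trace.re := by
  obtain ⟨h, hc, hh⟩ := hf
  refine ⟨fun t => (h t).trace.re, Complex.continuous_re.comp hc.matrix_trace, fun t => ?_⟩
  simp only [hh, Matrix.trace_add, Matrix.trace_smul, Complex.add_re, Complex.smul_re]

lemma HasQuadraticExpansion.lin_comb {f g : ℝ → ℝ} {a b c a' b' c' : ℝ}
    (hf : HasQuadraticExpansion f a b c) (hg : HasQuadraticExpansion g a' b' c') (r s : ℝ) :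
    HasQuadraticExpansion (fun t => r * f t + s * g t) (r * a + s * a') (r * b + s * b')
      (r * c + s * c') := by
  obtain ⟨h, hc, hh⟩ := hf
  obtain ⟨k, kc, hk⟩ := hg
  refine ⟨fun t => r * h t + s * k t, by fun_prop, fun t => ?_⟩
  simp only [hh, hk, smul_eq_mul]
  ring

/-- The Lagrange multiplier of the `j`-th unit-norm constraint at `Z`. -/
def lagrangeMultiplier {n p : ℕ} (A : Matrix (Fin n) (Fin n) ℂ) (μ : ℝ)
    (Z : Matrix (Fin n) (Fin p) ℂ) (j : Fin p) : ℝ :=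
  ((Zᴴ * A * Z + (μ : ℂ) • (Zᴴ * Z * (Zᴴ * Z))) j j).re

/-- First- and second-order necessary conditions for local minimality. -/
lemma IsLocalMinimizer.necessary_conditions {n p : ℕ} {A : Matrix (Fin n) (Fin n) ℂ} {μ : ℝ}
    {Z ξ : Matrix (Fin n) (Fin p) ℂ} (hA : A.IsHermitian)
    (hmin : IsLocalMinimizer A μ Z) (hZ : Z ∈ OBset n p) (hξ : ∀ j, (Zᴴ * ξ) j j = 0) :
    (ξᴴ * (A * Z + (μ : ℂ) • (Z * (Zᴴ * Z)))).trace.re = 0 ∧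
    0 ≤ (ξᴴ * A * ξ).trace.re
      - ∑ j, colNormSq ξ j * lagrangeMultiplier A μ Z j
      + μ * (Zᴴ * Z * (ξᴴ * ξ)).trace.re
      + μ / 2 * ((Zᴴ * ξ + ξᴴ * Z) * (Zᴴ * ξ + ξᴴ * Z)).trace.re := by
  have hN := hasQuadraticExpansion_normalizer ξ
  have hB : HasQuadraticExpansion (fun t : ℝ => (Z + t • ξ)ᴴ * A * (Z + t • ξ))
      (Zᴴ * A * Z) (Zᴴ * A * ξ + ξᴴ * A * Z) (ξᴴ * A * ξ) := by
    refine .quadratic fun t => ?_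
    simp only [Matrix.conjTranspose_add, Matrix.conjTranspose_smul, star_trivial,
      Matrix.add_mul, Matrix.mul_add, Matrix.smul_mul, Matrix.mul_smul]
    module
  have hH : HasQuadraticExpansion (fun t : ℝ => (Z + t • ξ)ᴴ * (Z + t • ξ))
      (Zᴴ * Z) (Zᴴ * ξ + ξᴴ * Z) (ξᴴ * ξ) := by
    refine .quadratic fun t => ?_
    simp only [Matrix.conjTranspose_add, Matrix.conjTranspose_smul, star_trivial,
      Matrix.add_mul, Matrix.mul_add, Matrix.smul_mul, Matrix.mul_smul]
    module
  have hF := ((hN.mul hB).re_trace).lin_comb (((hN.mul hH).mul (hN.mul hH)).re_trace)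
    (1 / 2) (μ / 4)
  simp only [← gmu_normalizedCurve] at hF
  obtain ⟨h1, h2⟩ := hF.linear_eq_zero_and_quadratic_nonneg (hmin.eventually_le hZ hξ)
  have hre : ∀ M : Matrix (Fin p) (Fin p) ℂ, Mᴴ.trace.re = M.trace.re := fun M => by
    rw [Matrix.trace_conjTranspose]; simp
  simp only [Matrix.one_mul, Matrix.zero_mul, add_zero] at h1 h2
  set G := Zᴴ * Z with hG
  set K := Zᴴ * ξ + ξᴴ * Z with hK
  set C : Matrix (Fin p) (Fin p) ℂ := Matrix.diagonal fun j => (colNormSq ξ j : ℂ) with hC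
  have hGH : Gᴴ = G := by simp [hG]
  constructor
  · have e1 : (Zᴴ * A * ξ).trace.re = (ξᴴ * A * Z).trace.re := by
      rw [← hre]
      simp [Matrix.conjTranspose_mul, hA.eq, Matrix.mul_assoc]
    have e2 : (G * K).trace.re = 2 * (ξᴴ * (Z * G)).trace.re := by
      have : (G * (Zᴴ * ξ)).trace.re = (G * (ξᴴ * Z)).trace.re := by
        rw [← hre, Matrix.conjTranspose_mul, hGH, Matrix.trace_mul_comm]
        simp
      rw [hK, Matrix.mul_add, Matrix.trace_add, Complex.add_re, this,
        Matrix.trace_mul_comm G, Matrix.mul_assoc]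
      ring
    have e3 : (K * G).trace.re = (G * K).trace.re := by rw [Matrix.trace_mul_comm]
    rw [Matrix.trace_add, Matrix.trace_add, Complex.add_re, Complex.add_re, e1, e3, e2] at h1
    rw [Matrix.mul_add, Matrix.trace_add, Complex.add_re, Matrix.mul_smul, Matrix.trace_smul,
      smul_eq_mul, Complex.re_ofReal_mul, ← Matrix.mul_assoc]
    linarith
  · have e1 : ∀ M : Matrix (Fin p) (Fin p) ℂ, (C * M).trace.re = ∑ j, colNormSq ξ j * (M j j).re := by
      intro M
      simp [hC, Matrix.trace, Matrix.diagonal_mul]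
    have e2 : ∑ j, colNormSq ξ j * lagrangeMultiplier A μ Z j =
        (C * (Zᴴ * A * Z)).trace.re + μ * (C * (G * G)).trace.re := by
      rw [e1, e1, Finset.mul_sum, ← Finset.sum_add_distrib]
      refine Finset.sum_congr rfl fun j _ => ?_
      simp only [lagrangeMultiplier, ← hG, Matrix.add_apply, Matrix.smul_apply, smul_eq_mul,
        Complex.add_re, Complex.re_ofReal_mul]
      ring
    have e3 : (G * (C * G)).trace.re = (C * (G * G)).trace.re := by
      rw [Matrix.trace_mul_comm, Matrix.mul_assoc]
    have e4 : (ξᴴ * ξ * G).trace.re = (G * (ξᴴ * ξ)).trace.re := by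
      rw [Matrix.trace_mul_comm]
    rw [e2]
    simp only [Matrix.neg_mul, Matrix.mul_add, Matrix.mul_neg, Matrix.add_mul, Matrix.trace_add,
      Matrix.trace_neg, Complex.add_re, Complex.neg_re, e3, e4, Matrix.mul_assoc C G G] at h2
    linarith

lemma re_trace_conjTranspose_mul_self {n p : ℕ} (ξ : Matrix (Fin n) (Fin p) ℂ) :
    (ξᴴ * ξ).trace.re = ∑ j, colNormSq ξ j := by
  simp [Matrix.trace, conjTranspose_mul_self_diag]

lemma eq_zero_of_re_trace_eq_zero {n p : ℕ} {ξ : Matrix (Fin n) (Fin p) ℂ}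
    (h : (ξᴴ * ξ).trace.re = 0) : ξ = 0 := by
  rw [re_trace_conjTranspose_mul_self,
    Finset.sum_eq_zero_iff_of_nonneg fun j _ => colNormSq_nonneg ξ j] at h
  ext i j
  have := h j (Finset.mem_univ j)
  rw [colNormSq, Finset.sum_eq_zero_iff_of_nonneg fun i _ => Complex.normSq_nonneg _] at this
  simpa using this i (Finset.mem_univ i)

lemma IsLocalMinimizer.stationarity {n p : ℕ} {A : Matrix (Fin n) (Fin n) ℂ} {μ : ℝ}
    {Z : Matrix (Fin n) (Fin p) ℂ} (hA : A.IsHermitian)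
    (hmin : IsLocalMinimizer A μ Z) (hZ : Z ∈ OBset n p) :
    A * Z + (μ : ℂ) • (Z * (Zᴴ * Z)) =
      Z * Matrix.diagonal fun j => (lagrangeMultiplier A μ Z j : ℂ) := by
  set S := A * Z + (μ : ℂ) • (Z * (Zᴴ * Z)) with hS
  have hZS : Zᴴ * S = Zᴴ * A * Z + (μ : ℂ) • (Zᴴ * Z * (Zᴴ * Z)) := by
    simp [hS, Matrix.mul_add, Matrix.mul_assoc]
  have hherm : (Zᴴ * S)ᴴ = Zᴴ * S := by
    rw [hZS]
    simp [Matrix.conjTranspose_add, Matrix.conjTranspose_smul, Matrix.conjTranspose_mul, hA.eq,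
      Matrix.mul_assoc]
  have hdiag : ∀ j, (Zᴴ * S) j j = (lagrangeMultiplier A μ Z j : ℂ) := fun j => by
    have h := congrFun (congrFun hherm j) j
    rw [Matrix.conjTranspose_apply] at h
    rw [lagrangeMultiplier, ← hZS]
    exact (Complex.conj_eq_iff_re.mp h).symm
  set D : Matrix (Fin p) (Fin p) ℂ :=
    Matrix.diagonal fun j => (lagrangeMultiplier A μ Z j : ℂ) with hD
  have htan : ∀ j, (Zᴴ * (S - Z * D)) j j = 0 := fun j => by
    rw [Matrix.mul_sub, ← Matrix.mul_assoc, Matrix.sub_apply, hD, Matrix.mul_diagonal, hZ j,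
      hdiag, one_mul, sub_self]
  have htan' : ∀ j, ((S - Z * D)ᴴ * Z) j j = 0 := fun j => by
    have := congrArg star (htan j)
    rwa [← Matrix.conjTranspose_apply, Matrix.conjTranspose_mul,
      Matrix.conjTranspose_conjTranspose, star_zero] at this
  have h1 := (hmin.necessary_conditions hA hZ htan).1
  rw [← hS] at h1
  have h2 : ((S - Z * D)ᴴ * (Z * D)).trace = 0 := by
    rw [← Matrix.mul_assoc]
    refine Finset.sum_eq_zero fun j _ => ?_
    rw [Matrix.diag_apply, hD, Matrix.mul_diagonal, ← hD, htan', zero_mul]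
  refine sub_eq_zero.mp (eq_zero_of_re_trace_eq_zero ?_)
  rw [Matrix.mul_sub, Matrix.trace_sub, h2, sub_zero, h1]

lemma IsLocalMinimizer.rank_one_condition {n p : ℕ} {A : Matrix (Fin n) (Fin n) ℂ} {μ : ℝ}
    {Z : Matrix (Fin n) (Fin p) ℂ} (hA : A.IsHermitian)
    (hmin : IsLocalMinimizer A μ Z) (hZ : Z ∈ OBset n p) {x : Fin n → ℂ} (hx : Zᴴ *ᵥ x = 0)
    (u : Fin p → ℂ) :
    0 ≤ (star x ⬝ᵥ A *ᵥ x).re * (star u ⬝ᵥ u).re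
      - (star x ⬝ᵥ x).re * ∑ j, Complex.normSq (u j) * lagrangeMultiplier A μ Z j
      + μ * ((star x ⬝ᵥ x).re * (star u ⬝ᵥ (Zᴴ * Z) *ᵥ u).re) := by
  set ξ : Matrix (Fin n) (Fin p) ℂ := Matrix.vecMulVec x (star u) with hξ
  have h0 : Zᴴ * ξ = 0 := by
    rw [hξ, Matrix.mul_vecMulVec, hx]
    ext; simp [Matrix.vecMulVec_apply]
  have h0' : ξᴴ * Z = 0 := by
    have := congrArg Matrix.conjTranspose h0
    simpa [Matrix.conjTranspose_mul] using this
  have h := (hmin.necessary_conditions hA hZ (ξ := ξ) (by simp [h0])).2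
  have hre : ∀ {m : ℕ} (v : Fin m → ℂ), (star v ⬝ᵥ v) = ((star v ⬝ᵥ v).re : ℂ) := fun v => by
    refine (Complex.conj_eq_iff_re.mp ?_).symm
    simp [dotProduct, mul_comm]
  have hξH : ξᴴ = Matrix.vecMulVec u (star x) := by
    rw [hξ, Matrix.conjTranspose_vecMulVec, star_star]
  have hc : ∀ j, colNormSq ξ j = (star x ⬝ᵥ x).re * Complex.normSq (u j) := fun j => by
    simp [colNormSq, hξ, Matrix.vecMulVec_apply, dotProduct, Finset.sum_mul,
      Complex.normSq_apply]
    exact Finset.sum_congr rfl fun i _ => by ring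
  have e1 : (ξᴴ * A * ξ).trace = (star x ⬝ᵥ A *ᵥ x) * (star u ⬝ᵥ u) := by
    rw [Matrix.mul_assoc, hξ, Matrix.mul_vecMulVec, ← hξ, hξH, Matrix.vecMulVec_mul_vecMulVec,
      Matrix.trace_vecMulVec, dotProduct_smul, dotProduct_comm u]
    rfl
  have e2 : (Zᴴ * Z * (ξᴴ * ξ)).trace = (star x ⬝ᵥ x) * (star u ⬝ᵥ (Zᴴ * Z) *ᵥ u) := by
    rw [hξH, hξ, Matrix.vecMulVec_mul_vecMulVec, Matrix.mul_vecMulVec,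
      Matrix.trace_vecMulVec, dotProduct_smul, dotProduct_comm _ (star u)]
    rfl
  rw [h0, h0', e1, e2] at h
  rw [hre u, hre x, mul_comm _ ((_ : ℝ) : ℂ), Complex.re_ofReal_mul, Complex.re_ofReal_mul] at h
  simp only [hc, mul_assoc, add_zero, Matrix.trace_zero, Complex.zero_re,
    mul_zero, ← Finset.mul_sum] at h
  linarith

lemma re_star_dotProduct_self {m : ℕ} (v : Fin m → ℂ) :
    (star v ⬝ᵥ v).re = ∑ i, Complex.normSq (v i) := by
  simp [dotProduct, Complex.normSq_apply]

lemma re_star_dotProduct_self_pos {m : ℕ} {v : Fin m → ℂ} (hv : v ≠ 0) :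
    0 < (star v ⬝ᵥ v).re := by
  rw [re_star_dotProduct_self]
  obtain ⟨i, hi⟩ := Function.ne_iff.mp hv
  exact Finset.sum_pos' (fun i _ => Complex.normSq_nonneg _)
    ⟨i, Finset.mem_univ i, Complex.normSq_pos.mpr hi⟩

lemma lagrangeMultiplier_pos {n p : ℕ} {A : Matrix (Fin n) (Fin n) ℂ} (hA : A.IsHermitian)
    {μ : ℝ} (hμ : 0 < μ) (hlow : ∀ i, -μ < hA.eigenvalues i)
    {Z : Matrix (Fin n) (Fin p) ℂ} (hZ : Z ∈ OBset n p) (j : Fin p) :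
    0 < lagrangeMultiplier A μ Z j := by
  set E : Matrix (Fin n) (Fin n) ℂ := (hA.eigenvectorUnitary : Matrix (Fin n) (Fin n) ℂ) with hE
  have hEE : E * Eᴴ = 1 := Matrix.mem_unitaryGroup_iff.mp hA.eigenvectorUnitary.2
  have hAE : A = E * Matrix.diagonal (fun i => (hA.eigenvalues i : ℂ)) * Eᴴ := by
    conv_lhs => rw [hA.spectral_theorem]
    rfl
  have hone : colNormSq (Eᴴ * Z) j = 1 := by
    have h := conjTranspose_mul_self_diag (Eᴴ * Z) j
    rw [Matrix.conjTranspose_mul, Matrix.conjTranspose_conjTranspose, Matrix.mul_assoc,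
      ← Matrix.mul_assoc E, hEE, Matrix.one_mul, hZ j] at h
    exact_mod_cast h.symm
  have h1 : ((Zᴴ * A * Z) j j).re =
      ∑ i, hA.eigenvalues i * Complex.normSq ((Eᴴ * Z) i j) := by
    have : Zᴴ * A * Z = (Eᴴ * Z)ᴴ * (Matrix.diagonal (fun i => (hA.eigenvalues i : ℂ)) *
        (Eᴴ * Z)) := by
      conv_lhs => rw [hAE]
      simp [Matrix.conjTranspose_mul, Matrix.mul_assoc]
    rw [this, Matrix.mul_apply, Complex.re_sum]
    refine Finset.sum_congr rfl fun i _ => ?_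
    rw [Matrix.diagonal_mul, Matrix.conjTranspose_apply, mul_left_comm, Complex.re_ofReal_mul,
      RCLike.star_def, ← Complex.normSq_eq_conj_mul_self, Complex.ofReal_re]
  have h2 : -μ < ((Zᴴ * A * Z) j j).re := by
    have h3 : ((Zᴴ * A * Z) j j).re - (-μ) * colNormSq (Eᴴ * Z) j =
        ∑ i, (hA.eigenvalues i + μ) * Complex.normSq ((Eᴴ * Z) i j) := by
      rw [h1, colNormSq, Finset.mul_sum, ← Finset.sum_sub_distrib]
      exact Finset.sum_congr rfl fun i _ => by ring
    have h4 : ∃ i ∈ Finset.univ, 0 < Complex.normSq ((Eᴴ * Z) i j) := by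
      by_contra! hcon
      have : colNormSq (Eᴴ * Z) j ≤ 0 := Finset.sum_nonpos fun i hi => hcon i hi
      linarith
    have h5 : 0 < ∑ i, (hA.eigenvalues i + μ) * Complex.normSq ((Eᴴ * Z) i j) := by
      refine Finset.sum_pos' (fun i _ => mul_nonneg ?_ (Complex.normSq_nonneg _)) ?_
      · linarith [hlow i]
      · obtain ⟨i, hi, h⟩ := h4
        exact ⟨i, hi, mul_pos (by linarith [hlow i]) h⟩
    rw [hone] at h3
    linarith
  have h6 : 1 ≤ ((Zᴴ * Z * (Zᴴ * Z)) j j).re := by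
    have hGH : (Zᴴ * Z)ᴴ = Zᴴ * Z := by simp
    have : (Zᴴ * Z * (Zᴴ * Z)) j j = (colNormSq (Zᴴ * Z) j : ℂ) := by
      rw [← conjTranspose_mul_self_diag, hGH]
    rw [this, Complex.ofReal_re, colNormSq]
    have h7 := Finset.single_le_sum (f := fun i => Complex.normSq ((Zᴴ * Z) i j))
      (fun i _ => Complex.normSq_nonneg _) (Finset.mem_univ j)
    simpa [hZ j] using h7
  rw [lagrangeMultiplier, Matrix.add_apply, Matrix.smul_apply, smul_eq_mul, Complex.add_re,
    Complex.re_ofReal_mul]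
  nlinarith

lemma exists_conjTranspose_mulVec_eq_zero {n p : ℕ} (hpn : p ≤ n)
    {Z : Matrix (Fin n) (Fin p) ℂ} {u : Fin p → ℂ} (hu : u ≠ 0) (hZu : Z *ᵥ u = 0) :
    ∃ x : Fin n → ℂ, x ≠ 0 ∧ Zᴴ *ᵥ x = 0 := by
  by_contra! hcon
  have hinj : Function.Injective (Zᴴ).mulVecLin := by
    refine LinearMap.ker_eq_bot.mp (LinearMap.ker_eq_bot'.mpr fun x hx => ?_)
    by_contra hne
    exact hcon x hne hx
  have hle : n ≤ p := by simpa using LinearMap.finrank_le_finrank_of_injective hinj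
  obtain rfl := le_antisymm hpn hle
  have hdet : Z.det = 0 := Matrix.exists_mulVec_eq_zero_iff.mp ⟨u, hu, hZu⟩
  obtain ⟨x, hx, hZx⟩ := Matrix.exists_mulVec_eq_zero_iff.mpr
    (show (Zᴴ).det = 0 by rw [Matrix.det_conjTranspose, hdet, star_zero])
  exact hcon x hx hZx

lemma IsLocalMinimizer.mulVec_ne_zero {n p : ℕ} (hpn : p ≤ n)
    {A : Matrix (Fin n) (Fin n) ℂ} (hA : A.IsHermitian)
    (hneg : ∀ z : Fin n → ℂ, z ≠ 0 → (star z ⬝ᵥ A *ᵥ z).re < 0)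
    {μ : ℝ} (hμ : 0 < μ) (hlow : ∀ i, -μ < hA.eigenvalues i)
    {Z : Matrix (Fin n) (Fin p) ℂ} (hmin : IsLocalMinimizer A μ Z) (hZ : Z ∈ OBset n p)
    {u : Fin p → ℂ} (hu : u ≠ 0) : Z *ᵥ u ≠ 0 := by
  intro hZu
  obtain ⟨x, hx, hZx⟩ := exists_conjTranspose_mulVec_eq_zero hpn hu hZu
  have h := hmin.rank_one_condition hA hZ hZx u
  rw [← Matrix.mulVec_mulVec, hZu, Matrix.mulVec_zero, dotProduct_zero, Complex.zero_re,
    mul_zero, mul_zero, add_zero] at h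
  have h1 := mul_neg_of_neg_of_pos (hneg x hx) (re_star_dotProduct_self_pos hu)
  have h2 : 0 ≤ (star x ⬝ᵥ x).re *
      ∑ j, Complex.normSq (u j) * lagrangeMultiplier A μ Z j :=
    mul_nonneg (re_star_dotProduct_self_pos hx).le (Finset.sum_nonneg fun j _ =>
      mul_nonneg (Complex.normSq_nonneg _) (lagrangeMultiplier_pos hA hμ hlow hZ j).le)
  linarith

lemma IsLocalMinimizer.lagrangeMultiplier_eq {n p : ℕ} {A : Matrix (Fin n) (Fin n) ℂ} {μ : ℝ}
    {Z : Matrix (Fin n) (Fin p) ℂ} (hA : A.IsHermitian)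
    (hmin : IsLocalMinimizer A μ Z) (hZ : Z ∈ OBset n p) (j k : Fin p) :
    lagrangeMultiplier A μ Z j = lagrangeMultiplier A μ Z k := by
  by_contra hne
  have hjk : j ≠ k := fun h => hne (by rw [h])
  have hst := congrArg (fun M => Zᴴ * M) (hmin.stationarity hA hZ)
  set d := lagrangeMultiplier A μ Z with hd
  set D : Matrix (Fin p) (Fin p) ℂ := Matrix.diagonal fun j => (d j : ℂ) with hD
  set G := Zᴴ * Z with hG
  have hZG : ∀ l, G l l = 1 := hZ
  have hGH : Gᴴ = G := by simp [hG]
  have hDH : Dᴴ = D := by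
    rw [hD, Matrix.diagonal_conjTranspose]
    congr 1
    funext l
    simp
  have hst' : Zᴴ * A * Z = G * D - (μ : ℂ) • (G * G) := by
    simp only [Matrix.mul_add, Matrix.mul_smul, ← Matrix.mul_assoc] at hst
    rw [eq_sub_iff_add_eq]
    exact hst
  have hcomm : G * D = D * G := by
    have h1 : G * D = Zᴴ * A * Z + (μ : ℂ) • (G * G) := by rw [hst']; abel
    have h2 : (G * D)ᴴ = G * D := by
      rw [h1]
      simp [Matrix.conjTranspose_add, Matrix.conjTranspose_smul, Matrix.conjTranspose_mul, hA.eq,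
        hGH, Matrix.mul_assoc]
    rw [Matrix.conjTranspose_mul, hGH, hDH] at h2
    exact h2.symm
  have hoff : ∀ l m, d l ≠ d m → G l m = 0 := fun l m hlm => by
    have h := congrFun (congrFun hcomm l) m
    rw [hD, Matrix.mul_diagonal, Matrix.diagonal_mul, mul_comm, ← sub_eq_zero, ← sub_mul] at h
    rcases mul_eq_zero.mp h with h | h
    · exact absurd (by exact_mod_cast (sub_eq_zero.mp h).symm) hlm
    · exact h
  have hGjk : G j k = 0 := hoff j k hne
  have hGkj : G k j = 0 := hoff k j (Ne.symm hne)
  have key : ∀ a b : ℝ, 0 ≤ (a ^ 2 - b ^ 2) * (d k - d j) + μ * (a + b) ^ 2 := by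
    intro a b
    set B : Matrix (Fin p) (Fin p) ℂ :=
      Matrix.single k j (a : ℂ) + Matrix.single j k (b : ℂ) with hB
    have hBH : Bᴴ = Matrix.single j k (a : ℂ) + Matrix.single k j (b : ℂ) := by
      simp [hB, Matrix.conjTranspose_add, Matrix.conjTranspose_single]
    have htan : ∀ l, (Zᴴ * (Z * B)) l l = 0 := by
      intro l
      rw [← Matrix.mul_assoc, ← hG, hB, Matrix.mul_add, Matrix.add_apply]
      rcases eq_or_ne l j with rfl | hlj
      · simp [hjk, hGjk]
      · rcases eq_or_ne l k with rfl | hlk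
        · simp [hlj, hGkj]
        · simp [hlj, hlk]
    have h := (hmin.necessary_conditions hA hZ htan).2
    have hBB : B * Bᴴ = Matrix.single k k ((a : ℂ) ^ 2) + Matrix.single j j ((b : ℂ) ^ 2) := by
      rw [hBH, hB]
      simp [Matrix.mul_add, Matrix.add_mul, hjk, hjk.symm, pow_two]
    have hBGB : Bᴴ * G * B =
        Matrix.single j j ((a : ℂ) ^ 2) + Matrix.single k k ((b : ℂ) ^ 2) := by
      rw [hBH, hB]
      simp [Matrix.mul_add, Matrix.add_mul, Matrix.single_mul_mul_single, hGjk, hGkj, hZG,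
        pow_two]
    have hBGB' : B * G * B = Matrix.single j j ((a * b : ℂ)) + Matrix.single k k (a * b : ℂ) := by
      rw [hB]
      simp [Matrix.mul_add, Matrix.add_mul, Matrix.single_mul_mul_single, hGjk, hGkj, hZG,
        mul_comm (b : ℂ)]
    have e1 : ((Z * B)ᴴ * A * (Z * B)).trace.re =
        a ^ 2 * d k + b ^ 2 * d j - μ * (Bᴴ * (G * G) * B).trace.re := by
      have h1 : (Z * B)ᴴ * A * (Z * B) = Bᴴ * (G * D) * B - (μ : ℂ) • (Bᴴ * (G * G) * B) := by
        rw [← Matrix.smul_mul, ← Matrix.mul_smul, ← Matrix.sub_mul, ← Matrix.mul_sub, ← hst']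
        simp [Matrix.conjTranspose_mul, Matrix.mul_assoc]
      have h2 : (Bᴴ * (G * D) * B).trace = ((a ^ 2 * d k + b ^ 2 * d j : ℝ) : ℂ) := by
        rw [Matrix.mul_assoc, Matrix.trace_mul_comm, Matrix.mul_assoc, hBB, Matrix.mul_add,
          Matrix.trace_add, Matrix.trace_mul_single, Matrix.trace_mul_single, hD,
          Matrix.mul_diagonal, Matrix.mul_diagonal, hZG, hZG]
        simp [mul_comm]
      rw [h1, Matrix.trace_sub, Matrix.trace_smul, h2, smul_eq_mul, Complex.sub_re,
        Complex.re_ofReal_mul, Complex.ofReal_re]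
    have hN : (Z * B)ᴴ * (Z * B) = Bᴴ * G * B := by
      simp [Matrix.conjTranspose_mul, Matrix.mul_assoc, hG]
    have e2 : ∑ l, colNormSq (Z * B) l * d l = a ^ 2 * d j + b ^ 2 * d k := by
      have h1 : ((∑ l, colNormSq (Z * B) l * d l : ℝ) : ℂ) = (Bᴴ * G * B * D).trace := by
        rw [← hN, Matrix.trace, Complex.ofReal_sum]
        refine Finset.sum_congr rfl fun l _ => ?_
        rw [Matrix.diag_apply, hD, Matrix.mul_diagonal, conjTranspose_mul_self_diag,
          Complex.ofReal_mul]
      have h2 : (Bᴴ * G * B * D).trace = ((a ^ 2 * d j + b ^ 2 * d k : ℝ) : ℂ) := by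
        rw [hBGB, Matrix.add_mul, Matrix.trace_add, Matrix.trace_single_mul,
          Matrix.trace_single_mul, hD, Matrix.diagonal_apply_eq, Matrix.diagonal_apply_eq]
        simp
      exact_mod_cast h1.trans h2
    have e3 : (G * (Bᴴ * G * B)).trace.re = a ^ 2 + b ^ 2 := by
      rw [hBGB, Matrix.mul_add, Matrix.trace_add, Matrix.trace_mul_single,
        Matrix.trace_mul_single, hZG, hZG]
      simp [← Complex.ofReal_pow]
    have e4 : (G * B * (G * B)).trace.re = 2 * (a * b) := by
      rw [Matrix.mul_assoc, ← Matrix.mul_assoc B, hBGB', Matrix.mul_add, Matrix.trace_add,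
        Matrix.trace_mul_single, Matrix.trace_mul_single, hZG, hZG]
      simp
      ring
    have e5 : (Bᴴ * G * (Bᴴ * G)).trace.re = 2 * (a * b) := by
      have h1 : Bᴴ * G * (Bᴴ * G) = (G * B * (G * B))ᴴ := by
        simp only [Matrix.conjTranspose_mul, hGH]
      rw [h1, Matrix.trace_conjTranspose, ← e4]
      simp
    have e6 : (Bᴴ * G * (G * B)).trace = (Bᴴ * (G * G) * B).trace := by
      simp only [Matrix.mul_assoc]
    have e7 : (G * B * (Bᴴ * G)).trace = (Bᴴ * (G * G) * B).trace := by
      rw [Matrix.trace_mul_comm, e6]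
    have hK : Zᴴ * (Z * B) + (Z * B)ᴴ * Z = G * B + Bᴴ * G := by
      rw [Matrix.conjTranspose_mul, Matrix.mul_assoc, ← hG, ← Matrix.mul_assoc]
    rw [hK, hN, ← hd, e1, e2, e3] at h
    simp only [Matrix.add_mul, Matrix.mul_add, Matrix.trace_add, Complex.add_re, e4, e5, e6,
      e7] at h
    linarith
  have hδ : d k - d j ≠ 0 := fun h => hne (sub_eq_zero.mp h).symm
  set r := (-μ - 1) / (d k - d j) with hr
  have hrδ : r * (d k - d j) = -μ - 1 := div_mul_cancel₀ _ hδ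
  have h := key ((1 + r) / 2) ((1 - r) / 2)
  nlinarith

/-- If weights `t i ∈ [0, 1]` of total mass `p` are concentrated on the smallest values of a
monotone family, weighted sums agree with sums over the first `p` indices. -/
lemma sum_weights_eq_sum_castLE {n p : ℕ} (hp : 0 < p) (hpn : p ≤ n) {l : Fin n → ℝ}
    (hl : Monotone l) {t : Fin n → ℝ} (h0 : ∀ i, 0 ≤ t i) (h1 : ∀ i, t i ≤ 1)
    (hsum : ∑ i, t i = p) (hsep : ∀ i j, 0 < t j → t i < 1 → l j ≤ l i) (f : ℝ → ℝ) :
    ∑ i, t i * f (l i) = ∑ j : Fin p, f (l (Fin.castLE hpn j)) := by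
  have hfirst : ∀ g : Fin n → ℝ, ∑ i : Fin n, (if (i : ℕ) < p then g i else 0) =
      ∑ j : Fin p, g (Fin.castLE hpn j) := by
    intro g
    rw [← Finset.sum_filter]
    symm
    refine Finset.sum_bij (fun j _ => Fin.castLE hpn j) (by simp)
      (fun a _ b _ h => Fin.castLE_injective hpn h)
      (fun i hi => ⟨⟨i, by simpa using hi⟩, by simp, rfl⟩) (fun _ _ => rfl)
  have hmass : ∑ i : Fin n, (if (i : ℕ) < p then (1 : ℝ) else 0) = p := by
    rw [hfirst fun _ => 1]; simp
  set q : Fin n := ⟨p - 1, by omega⟩ with hq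
  have hlow : ∀ i : Fin n, l i < l q → t i = 1 ∧ (i : ℕ) < p := by
    intro i hi
    have hiq : (i : ℕ) < p := by
      by_contra hcon
      exact absurd (hl (show q ≤ i from Fin.mk_le_of_le_val (by omega))) (not_le.mpr hi)
    refine ⟨?_, hiq⟩
    by_contra hne
    have hlt := lt_of_le_of_ne (h1 i) hne
    have hz : ∀ k : Fin n, q ≤ k → t k = 0 := fun k hk => by
      by_contra hk0
      have := hsep i k (lt_of_le_of_ne (h0 k) (Ne.symm hk0)) hlt
      linarith [hl hk]
    have : ∑ i, t i < ∑ i : Fin n, (if (i : ℕ) < p then (1 : ℝ) else 0) := by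
      refine Finset.sum_lt_sum (fun k _ => ?_) ⟨q, Finset.mem_univ q, ?_⟩
      · split_ifs with hk
        · exact h1 k
        · exact (hz k (Fin.mk_le_of_le_val (by omega))).le
      · rw [hz q le_rfl, if_pos (by simp [hq]; omega)]
        exact one_pos
    linarith
  have hhigh : ∀ i : Fin n, l q < l i → t i = 0 ∧ ¬ (i : ℕ) < p := by
    intro i hi
    have hiq : ¬ (i : ℕ) < p := by
      intro hcon
      exact absurd (hl (show i ≤ q from Fin.le_def.mpr (by simp [hq]; omega))) (not_le.mpr hi)
    refine ⟨?_, hiq⟩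
    by_contra hne
    have hlt := lt_of_le_of_ne (h0 i) (Ne.symm hne)
    have hz : ∀ k : Fin n, k ≤ q → t k = 1 := fun k hk => by
      by_contra hk0
      have := hsep k i hlt (lt_of_le_of_ne (h1 k) hk0)
      linarith [hl hk]
    have : ∑ i : Fin n, (if (i : ℕ) < p then (1 : ℝ) else 0) < ∑ i, t i := by
      refine Finset.sum_lt_sum (fun k _ => ?_) ⟨i, Finset.mem_univ i, ?_⟩
      · split_ifs with hk
        · exact (hz k (Fin.le_def.mpr (by simp [hq]; omega))).ge
        · exact h0 k
      · rwa [if_neg hiq]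
    linarith
  rw [← hfirst fun i => f (l i), ← sub_eq_zero, ← Finset.sum_sub_distrib]
  have : ∀ i : Fin n, t i * f (l i) - (if (i : ℕ) < p then f (l i) else 0) =
      (t i - if (i : ℕ) < p then 1 else 0) * f (l q) := by
    intro i
    rcases lt_trichotomy (l i) (l q) with h | h | h
    · obtain ⟨ht, hi⟩ := hlow i h
      simp [ht, hi]
    · rw [h]
      split_ifs <;> ring
    · obtain ⟨ht, hi⟩ := hhigh i h
      simp [ht, hi]
  rw [Finset.sum_congr rfl fun i _ => this i, ← Finset.sum_mul, Finset.sum_sub_distrib, hsum,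
    hmass, sub_self, zero_mul]

lemma monotone_sortedEig {n : ℕ} {A : Matrix (Fin n) (Fin n) ℂ} (hA : A.IsHermitian) :
    Monotone (sortedEig hA) := Tuple.monotone_sort hA.eigenvalues

lemma exists_sorted_eigenbasis {n : ℕ} {A : Matrix (Fin n) (Fin n) ℂ} (hA : A.IsHermitian) :
    ∃ E : Matrix (Fin n) (Fin n) ℂ, Eᴴ * E = 1 ∧ E * Eᴴ = 1 ∧
      A * E = E * Matrix.diagonal fun i => (sortedEig hA i : ℂ) := by
  set U : Matrix (Fin n) (Fin n) ℂ := (hA.eigenvectorUnitary : Matrix (Fin n) (Fin n) ℂ) with hU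
  have h1 : U * Uᴴ = 1 := Matrix.mem_unitaryGroup_iff.mp hA.eigenvectorUnitary.2
  have h2 : Uᴴ * U = 1 := Matrix.mem_unitaryGroup_iff'.mp hA.eigenvectorUnitary.2
  have hAU : A = U * Matrix.diagonal (fun i => (hA.eigenvalues i : ℂ)) * Uᴴ := by
    conv_lhs => rw [hA.spectral_theorem]
    rfl
  have hAU' : A * U = U * Matrix.diagonal (fun i => (hA.eigenvalues i : ℂ)) := by
    conv_lhs => rw [hAU]
    rw [Matrix.mul_assoc, h2, Matrix.mul_one]
  set σ := Tuple.sort hA.eigenvalues with hσ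
  refine ⟨U.submatrix id σ, ?_, ?_, ?_⟩
  · rw [Matrix.conjTranspose_submatrix, ← Matrix.submatrix_mul _ _ _ _ _ Function.bijective_id,
      h2, Matrix.submatrix_one_equiv]
  · rw [Matrix.conjTranspose_submatrix, ← Matrix.submatrix_mul _ _ _ _ _ σ.bijective, h1,
      Matrix.submatrix_id_id]
  · have h3 : (Matrix.diagonal fun i => (sortedEig hA i : ℂ)) =
        (Matrix.diagonal fun i => (hA.eigenvalues i : ℂ)).submatrix σ σ := by
      rw [Matrix.submatrix_diagonal_equiv]
      rfl
    rw [h3, ← Matrix.submatrix_mul _ _ _ _ _ σ.bijective, ← hAU']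
    rfl

lemma IsLocalMinimizer.gmu_eq {n p : ℕ} (hp : 0 < p) (hpn : p ≤ n)
    {A : Matrix (Fin n) (Fin n) ℂ} (hA : A.IsHermitian)
    (hneg : ∀ z : Fin n → ℂ, z ≠ 0 → (star z ⬝ᵥ A *ᵥ z).re < 0)
    {μ : ℝ} (hμ : 0 < μ) (hlow : ∀ i, -μ < hA.eigenvalues i)
    {Z : Matrix (Fin n) (Fin p) ℂ} (hmin : IsLocalMinimizer A μ Z) (hZ : Z ∈ OBset n p) :
    gmu A μ Z = (μ / 4) * ∑ j : Fin p,
      ((1 + ((∑ l : Fin p, sortedEig hA (Fin.castLE hpn l)) / p) / μ) ^ 2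
        - (sortedEig hA (Fin.castLE hpn j)) ^ 2 / μ ^ 2) := by
  set l := sortedEig hA with hl
  set d := lagrangeMultiplier A μ Z ⟨0, hp⟩ with hd
  have hdj : ∀ j, lagrangeMultiplier A μ Z j = d := fun j =>
    hmin.lagrangeMultiplier_eq hA hZ j _
  set G := Zᴴ * Z with hG
  have hGH : Gᴴ = G := by simp [hG]
  set M : Matrix (Fin p) (Fin p) ℂ := (d : ℂ) • 1 - (μ : ℂ) • G with hM
  have hAZ : A * Z = Z * M := by
    have h := hmin.stationarity hA hZ
    have hD : (Matrix.diagonal fun j => (lagrangeMultiplier A μ Z j : ℂ)) = (d : ℂ) • 1 := by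
      rw [Matrix.smul_one_eq_diagonal]
      simp only [hdj]
    rw [hD, ← eq_sub_iff_add_eq] at h
    rw [h, hM, Matrix.mul_sub, Matrix.mul_smul _ (μ : ℂ)]
  have hMH : Mᴴ = M := by
    simp [hM, Matrix.conjTranspose_sub, Matrix.conjTranspose_smul, hGH]
  have hZA : Zᴴ * A = M * Zᴴ := by
    have h := congrArg Matrix.conjTranspose hAZ
    rwa [Matrix.conjTranspose_mul, Matrix.conjTranspose_mul, hA.eq, hMH] at h
  have hdet : IsUnit G.det := by
    rw [isUnit_iff_ne_zero]
    intro h0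
    obtain ⟨u, hu, hGu⟩ := Matrix.exists_mulVec_eq_zero_iff.mpr h0
    have h := re_star_dotProduct_self_pos (hmin.mulVec_ne_zero hpn hA hneg hμ hlow hZ hu)
    rw [Matrix.star_mulVec, ← Matrix.dotProduct_mulVec, Matrix.mulVec_mulVec, ← hG, hGu,
      dotProduct_zero, Complex.zero_re] at h
    exact h.false
  have hGi : G⁻¹ * G = 1 := Matrix.nonsing_inv_mul G hdet
  have hGi' : G * G⁻¹ = 1 := Matrix.mul_nonsing_inv G hdet
  have hGiH : (G⁻¹)ᴴ = G⁻¹ := by rw [Matrix.conjTranspose_nonsing_inv, hGH]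
  have hMG : M * G⁻¹ = G⁻¹ * M := by
    simp [hM, Matrix.sub_mul, Matrix.mul_sub, hGi, hGi']
  set P := Z * (G⁻¹ * Zᴴ) with hP
  have hZP : Zᴴ * P = Zᴴ := by
    rw [hP, ← Matrix.mul_assoc, ← hG, ← Matrix.mul_assoc, hGi', Matrix.one_mul]
  have hPP : P * P = P := by
    conv_lhs => rw [hP, Matrix.mul_assoc, Matrix.mul_assoc, ← hP, hZP]
  have hPH : Pᴴ = P := by
    simp [hP, Matrix.conjTranspose_mul, hGiH, Matrix.mul_assoc]
  have hAP : A * P = P * A := by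
    rw [hP, ← Matrix.mul_assoc, hAZ, Matrix.mul_assoc, Matrix.mul_assoc, Matrix.mul_assoc, hZA,
      ← Matrix.mul_assoc M, hMG, Matrix.mul_assoc]
  obtain ⟨E, hE1, hE2, hAE⟩ := exists_sorted_eigenbasis hA
  rw [← hl] at hAE
  set L : Matrix (Fin n) (Fin n) ℂ := Matrix.diagonal fun i => (l i : ℂ) with hL
  set R := Eᴴ * P * E with hR
  have hRH : Rᴴ = R := by simp [hR, Matrix.conjTranspose_mul, hPH, Matrix.mul_assoc]
  have hRR : Rᴴ * R = R := by
    rw [hRH, hR]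
    calc Eᴴ * P * E * (Eᴴ * P * E) = Eᴴ * (P * (E * Eᴴ) * P) * E := by
          simp only [Matrix.mul_assoc]
      _ = Eᴴ * P * E := by rw [hE2, Matrix.mul_one, hPP]
  set t : Fin n → ℝ := colNormSq R with ht
  have hRt : ∀ i, R i i = (t i : ℂ) := fun i => by
    rw [ht, ← conjTranspose_mul_self_diag, hRR]
  have ht0 : ∀ i, 0 ≤ t i := colNormSq_nonneg R
  set X := (1 - P) * E with hX
  have hXt : ∀ i, colNormSq X i = 1 - t i := fun i => by
    have h : Xᴴ * X = 1 - R := by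
      rw [hX, hR, Matrix.conjTranspose_mul, Matrix.conjTranspose_sub, hPH,
        Matrix.conjTranspose_one]
      calc Eᴴ * (1 - P) * ((1 - P) * E) = Eᴴ * ((1 - P) * (1 - P)) * E := by
            simp only [Matrix.mul_assoc]
        _ = 1 - Eᴴ * P * E := by
            rw [Matrix.mul_sub, Matrix.mul_one, Matrix.sub_mul, Matrix.one_mul, hPP, sub_self,
              sub_zero, Matrix.mul_sub, Matrix.mul_one, Matrix.sub_mul, hE1]
    have h' := conjTranspose_mul_self_diag X i
    rw [h, Matrix.sub_apply, Matrix.one_apply_eq, hRt] at h'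
    exact_mod_cast h'.symm
  have ht1 : ∀ i, t i ≤ 1 := fun i => by linarith [hXt i, colNormSq_nonneg X i]
  have hAX : A * X = X * L := by
    rw [hX, Matrix.mul_assoc, ← hAE, ← Matrix.mul_assoc, ← Matrix.mul_assoc, Matrix.mul_sub,
      Matrix.sub_mul, hAP, Matrix.mul_one, Matrix.sub_mul, Matrix.sub_mul, Matrix.one_mul]
  have hZX : Zᴴ * X = 0 := by
    rw [hX, ← Matrix.mul_assoc, Matrix.mul_sub, hZP, Matrix.mul_one, sub_self, Matrix.zero_mul]
  set U := G⁻¹ * Zᴴ * E with hU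
  have hMU : M * U = U * L := by
    rw [hU, Matrix.mul_assoc _ E, ← hAE, Matrix.mul_assoc G⁻¹, Matrix.mul_assoc G⁻¹,
      ← Matrix.mul_assoc M, hMG, ← Matrix.mul_assoc Zᴴ, hZA]
    simp only [Matrix.mul_assoc]
  have hUR : Eᴴ * (Z * U) = R := by
    rw [hU, hR, hP]
    simp only [Matrix.mul_assoc]
  have hsep : ∀ i j, 0 < t j → t i < 1 → l j ≤ l i := by
    intro i j hj hi
    set x : Fin n → ℂ := fun k => X k i with hx
    set u : Fin p → ℂ := fun k => U k j with hu
    have hZx : Zᴴ *ᵥ x = 0 := funext fun k => congrFun (congrFun hZX k) i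
    have hAx : A *ᵥ x = (l i : ℂ) • x := funext fun k => by
      have h := congrFun (congrFun hAX k) i
      rw [hL, Matrix.mul_diagonal, mul_comm] at h
      exact h
    have hMu : M *ᵥ u = (l j : ℂ) • u := funext fun k => by
      have h := congrFun (congrFun hMU k) j
      rw [hL, Matrix.mul_diagonal, mul_comm] at h
      exact h
    have hGu : (μ : ℂ) • (G *ᵥ u) = ((d - l j : ℝ) : ℂ) • u := by
      rw [hM, Matrix.sub_mulVec, Matrix.smul_mulVec, Matrix.smul_mulVec, Matrix.one_mulVec,
        sub_eq_iff_eq_add', ← sub_eq_iff_eq_add] at hMu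
      rw [← hMu, Complex.ofReal_sub, sub_smul]
    have hxpos : 0 < (star x ⬝ᵥ x).re := by
      rw [re_star_dotProduct_self]
      have := hXt i
      rw [colNormSq] at this
      linarith
    have hupos : 0 < (star u ⬝ᵥ u).re := by
      refine re_star_dotProduct_self_pos fun hu0 => ?_
      have h : R j j = 0 := by
        rw [← hUR, ← Matrix.mul_assoc, Matrix.mul_apply]
        exact Finset.sum_eq_zero fun k _ => by
          rw [show U k j = 0 from congrFun hu0 k, mul_zero]
      rw [hRt] at h
      exact hj.ne' (by exact_mod_cast h)
    have h := hmin.rank_one_condition hA hZ hZx u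
    have e1 : (star x ⬝ᵥ A *ᵥ x).re = l i * (star x ⬝ᵥ x).re := by
      rw [hAx, dotProduct_smul, smul_eq_mul, Complex.re_ofReal_mul]
    have e2 : μ * (star u ⬝ᵥ G *ᵥ u).re = (d - l j) * (star u ⬝ᵥ u).re := by
      rw [← Complex.re_ofReal_mul, ← smul_eq_mul, ← dotProduct_smul, hGu, dotProduct_smul,
        smul_eq_mul, Complex.re_ofReal_mul]
    have e3 : ∑ k, Complex.normSq (u k) * lagrangeMultiplier A μ Z k =
        (star u ⬝ᵥ u).re * d := by
      simp only [hdj, ← Finset.sum_mul, re_star_dotProduct_self]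
    rw [← hG, e1, e3, mul_left_comm μ, e2] at h
    have h' : 0 ≤ ((star x ⬝ᵥ x).re * (star u ⬝ᵥ u).re) * (l i - l j) := by linarith
    linarith [nonneg_of_mul_nonneg_right h' (mul_pos hxpos hupos)]
  have hLE : L * Eᴴ = Eᴴ * A := by
    have h := congrArg Matrix.conjTranspose hAE
    rw [Matrix.conjTranspose_mul, Matrix.conjTranspose_mul, hA.eq, hL,
      Matrix.diagonal_conjTranspose] at h
    rw [h, hL]
    congr 2
    funext i
    simp
  have hLR : L * R = Eᴴ * (A * P) * E := by
    rw [hR, ← Matrix.mul_assoc, ← Matrix.mul_assoc, hLE]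
    simp only [Matrix.mul_assoc]
  have hLLR : L * (L * R) = Eᴴ * (A * (A * P)) * E := by
    rw [hLR, ← Matrix.mul_assoc, ← Matrix.mul_assoc, hLE]
    simp only [Matrix.mul_assoc]
  have htrE : ∀ N : Matrix (Fin n) (Fin n) ℂ, (Eᴴ * N * E).trace = N.trace := fun N => by
    rw [Matrix.trace_mul_comm, ← Matrix.mul_assoc, hE2, Matrix.one_mul]
  have htrP : ∀ N : Matrix (Fin p) (Fin p) ℂ, (Z * (N * (G⁻¹ * Zᴴ))).trace = N.trace := fun N => by
    rw [Matrix.trace_mul_comm, Matrix.mul_assoc, Matrix.mul_assoc, ← hG, hGi, Matrix.mul_one]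
  have htrG : G.trace.re = p := by
    have : G.trace = ∑ j : Fin p, (1 : ℂ) := Finset.sum_congr rfl fun j _ => hZ j
    simp [this]
  have hsum : ∑ i, t i = p := by
    have h : ((∑ i, t i : ℝ) : ℂ) = p := by
      calc ((∑ i, t i : ℝ) : ℂ) = R.trace := by
            rw [Complex.ofReal_sum]
            exact Finset.sum_congr rfl fun i _ => (hRt i).symm
        _ = (Z * ((1 : Matrix (Fin p) (Fin p) ℂ) * (G⁻¹ * Zᴴ))).trace := by
            rw [hR, htrE, Matrix.one_mul]
        _ = p := by rw [htrP]; simp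
    exact_mod_cast h
  have hsum1 : ∑ i, t i * l i = M.trace.re := by
    have h : ((∑ i, t i * l i : ℝ) : ℂ) = M.trace := by
      calc ((∑ i, t i * l i : ℝ) : ℂ) = (L * R).trace := by
            rw [Complex.ofReal_sum]
            refine Finset.sum_congr rfl fun i _ => ?_
            rw [Matrix.diag_apply, hL, Matrix.diagonal_mul, hRt, Complex.ofReal_mul, mul_comm]
        _ = (Z * (M * (G⁻¹ * Zᴴ))).trace := by
            rw [hLR, htrE, hP, ← Matrix.mul_assoc, hAZ, Matrix.mul_assoc]
        _ = M.trace := htrP M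
    rw [← h, Complex.ofReal_re]
  have hsum2 : ∑ i, t i * l i ^ 2 = (M * M).trace.re := by
    have h : ((∑ i, t i * l i ^ 2 : ℝ) : ℂ) = (M * M).trace := by
      calc ((∑ i, t i * l i ^ 2 : ℝ) : ℂ) = (L * (L * R)).trace := by
            rw [Complex.ofReal_sum]
            refine Finset.sum_congr rfl fun i _ => ?_
            rw [Matrix.diag_apply, hL, Matrix.diagonal_mul, Matrix.diagonal_mul, hRt]
            push_cast
            ring
        _ = (Z * (M * M * (G⁻¹ * Zᴴ))).trace := by
            rw [hLLR, htrE, hP, ← Matrix.mul_assoc A Z, hAZ, Matrix.mul_assoc Z,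
              ← Matrix.mul_assoc A Z, hAZ]
            simp only [Matrix.mul_assoc]
        _ = (M * M).trace := htrP _
    rw [← h, Complex.ofReal_re]
  have hmono := monotone_sortedEig hA
  have hs1 := sum_weights_eq_sum_castLE hp hpn hmono ht0 ht1 hsum hsep (fun y => y)
  have hs2 := sum_weights_eq_sum_castLE hp hpn hmono ht0 ht1 hsum hsep (fun y => y ^ 2)
  rw [← hl] at hs1 hs2
  rw [hsum1] at hs1
  rw [hsum2] at hs2
  set γ := (G * G).trace.re with hγ
  have hM1 : M.trace.re = d * p - μ * p := by
    rw [hM, Matrix.trace_sub, Matrix.trace_smul, Matrix.trace_smul, Complex.sub_re, smul_eq_mul,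
      smul_eq_mul, Complex.re_ofReal_mul, Complex.re_ofReal_mul, htrG]
    simp
  have hGM : (G * M).trace.re = d * p - μ * γ := by
    rw [hM, Matrix.mul_sub, Matrix.mul_smul, Matrix.mul_smul, Matrix.mul_one, Matrix.trace_sub,
      Matrix.trace_smul, Matrix.trace_smul, Complex.sub_re, smul_eq_mul,
      smul_eq_mul, Complex.re_ofReal_mul, Complex.re_ofReal_mul, htrG]
  have hM2 : (M * M).trace.re = d * (d * p - μ * p) - μ * (d * p - μ * γ) := by
    rw [← hM1, ← hGM]
    nth_rewrite 1 [hM]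
    rw [Matrix.sub_mul, Matrix.smul_mul, Matrix.smul_mul, Matrix.one_mul, Matrix.trace_sub,
      Matrix.trace_smul, Matrix.trace_smul, Complex.sub_re, smul_eq_mul,
      smul_eq_mul, Complex.re_ofReal_mul, Complex.re_ofReal_mul]
  have hg : gmu A μ Z = (1 / 2) * (d * p - μ * γ) + (μ / 4) * γ := by
    rw [gmu, Matrix.mul_assoc, hAZ, ← Matrix.mul_assoc, ← hG, hGM]
  have hp' : (p : ℝ) ≠ 0 := by exact_mod_cast hp.ne'
  rw [hg, Finset.sum_sub_distrib, ← Finset.sum_div, ← hs1, ← hs2, hM1, hM2, Finset.sum_const,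
    Finset.card_univ, Fintype.card_fin, nsmul_eq_mul]
  field_simp
  ring

lemma sortedEig_neg {n : ℕ} {A : Matrix (Fin n) (Fin n) ℂ} (hA : A.IsHermitian)
    (hneg : ∀ z : Fin n → ℂ, z ≠ 0 → (star z ⬝ᵥ A *ᵥ z).re < 0) (i : Fin n) :
    sortedEig hA i < 0 := by
  obtain ⟨E, hE, -, hAE⟩ := exists_sorted_eigenbasis hA
  have h1 : Eᴴ * (A * E) = Matrix.diagonal fun i => (sortedEig hA i : ℂ) := by
    rw [hAE, ← Matrix.mul_assoc, hE, Matrix.one_mul]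
  have hE0 : (fun k => E k i) ≠ 0 := fun h0 => by
    have h := congrFun (congrFun hE i) i
    rw [Matrix.mul_apply, Matrix.one_apply_eq,
      Finset.sum_eq_zero fun k _ => by rw [show E k i = 0 from congrFun h0 k, mul_zero]] at h
    exact zero_ne_one h
  have h2 : star (fun k => E k i) ⬝ᵥ A *ᵥ (fun k => E k i) = (Eᴴ * (A * E)) i i := rfl
  have h3 := hneg _ hE0
  rwa [h2, h1, Matrix.diagonal_apply_eq, Complex.ofReal_re] at h3

lemma gmu_qtpmPoint {n p : ℕ} (hp : 0 < p) (hpn : p ≤ n)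
    {A : Matrix (Fin n) (Fin n) ℂ} (hA : A.IsHermitian)
    (hneg : ∀ z : Fin n → ℂ, z ≠ 0 → (star z ⬝ᵥ A *ᵥ z).re < 0)
    {μ : ℝ} (hμ : 0 < μ) (hlow : ∀ i, -μ < hA.eigenvalues i)
    {Q : Matrix (Fin n) (Fin p) ℂ} {V : Matrix (Fin p) (Fin p) ℂ} (hQ : Qᴴ * Q = 1)
    (hAQ : A * Q = Q * Matrix.diagonal fun j : Fin p => (sortedEig hA (Fin.castLE hpn j) : ℂ))
    (hV : Vᴴ * V = 1) :
    gmu A μ (qtpmPoint hpn hA μ Q V) = (μ / 4) * ∑ j : Fin p,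
      ((1 + ((∑ l : Fin p, sortedEig hA (Fin.castLE hpn l)) / p) / μ) ^ 2
        - (sortedEig hA (Fin.castLE hpn j)) ^ 2 / μ ^ 2) := by
  rw [qtpmPoint]
  set l : Fin p → ℝ := fun j => sortedEig hA (Fin.castLE hpn j) with hl
  set m : ℝ := (∑ j, l j) / p with hm
  have hp' : (0 : ℝ) < p := by exact_mod_cast hp
  have hm' : -μ ≤ m := by
    rw [hm, le_div_iff₀ hp']
    have h : ∑ j : Fin p, -μ ≤ ∑ j, l j := Finset.sum_le_sum fun j _ => (hlow _).le
    simp at h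
    linarith
  have hs : ∀ j, 0 ≤ 1 - (l j - m) / μ := fun j => by
    have hlj : l j < 0 := sortedEig_neg hA hneg _
    have : (l j - m) / μ ≤ 1 := by
      rw [div_le_one hμ]
      linarith
    linarith
  set D : Matrix (Fin p) (Fin p) ℂ :=
    Matrix.diagonal fun j => (Real.sqrt (1 - (l j - m) / μ) : ℂ) with hD
  have hDH : Dᴴ = D := by
    rw [hD, Matrix.diagonal_conjTranspose]
    congr 1
    funext j
    simp
  have hDD : D * D = Matrix.diagonal fun j => ((1 - (l j - m) / μ : ℝ) : ℂ) := by
    rw [hD, Matrix.diagonal_mul_diagonal]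
    congr 1
    funext j
    rw [← Complex.ofReal_mul, Real.mul_self_sqrt (hs j)]
  set L : Matrix (Fin p) (Fin p) ℂ := Matrix.diagonal fun j => (l j : ℂ) with hL
  have htr : ∀ N : Matrix (Fin p) (Fin p) ℂ, (V * (N * Vᴴ)).trace = N.trace := fun N => by
    rw [Matrix.trace_mul_comm, Matrix.mul_assoc, hV, Matrix.mul_one]
  have h1 : ((Q * D * Vᴴ)ᴴ * A * (Q * D * Vᴴ)).trace = (L * (D * D)).trace := by
    have : (Q * D * Vᴴ)ᴴ * A * (Q * D * Vᴴ) = V * (D * ((Qᴴ * (A * Q)) * D) * Vᴴ) := by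
      simp only [Matrix.conjTranspose_mul, Matrix.conjTranspose_conjTranspose, hDH,
        Matrix.mul_assoc]
    rw [this, htr, hAQ, ← Matrix.mul_assoc Qᴴ, hQ, Matrix.one_mul, Matrix.trace_mul_comm,
      Matrix.mul_assoc]
  have h2 : (Q * D * Vᴴ)ᴴ * (Q * D * Vᴴ) = V * (D * D * Vᴴ) := by
    calc (Q * D * Vᴴ)ᴴ * (Q * D * Vᴴ) = V * (D * ((Qᴴ * Q) * D) * Vᴴ) := by
          simp only [Matrix.conjTranspose_mul, Matrix.conjTranspose_conjTranspose, hDH,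
            Matrix.mul_assoc]
      _ = V * (D * D * Vᴴ) := by rw [hQ, Matrix.one_mul]
  have h3 : (V * (D * D * Vᴴ) * (V * (D * D * Vᴴ))).trace = (D * D * (D * D)).trace := by
    have : V * (D * D * Vᴴ) * (V * (D * D * Vᴴ)) = V * (D * D * (Vᴴ * V) * (D * D) * Vᴴ) := by
      simp only [Matrix.mul_assoc]
    rw [this, hV, Matrix.mul_one, htr]
  rw [gmu, h1, h2, h3, hDD, hL, Matrix.diagonal_mul_diagonal, Matrix.diagonal_mul_diagonal,
    Matrix.trace_diagonal, Matrix.trace_diagonal, Complex.re_sum, Complex.re_sum, Finset.mul_sum,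
    Finset.mul_sum, Finset.mul_sum, ← Finset.sum_add_distrib]
  refine Finset.sum_congr rfl fun j _ => ?_
  rw [← Complex.ofReal_mul, ← Complex.ofReal_mul, Complex.ofReal_re, Complex.ofReal_re]
  change _ = μ / 4 * ((1 + m / μ) ^ 2 - l j ^ 2 / μ ^ 2)
  field_simp
  ring

lemma isCompact_OBset {n p : ℕ} : IsCompact (OBset n p) := by
  have hbox : IsCompact (Set.univ.pi fun _ : Fin n => Set.univ.pi fun _ : Fin p =>
      Metric.closedBall (0 : ℂ) 1) :=
    isCompact_univ_pi fun _ => isCompact_univ_pi fun _ => isCompact_closedBall _ _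
  refine hbox.of_isClosed_subset ?_ fun X hX i _ j _ => ?_
  · have : OBset n p = ⋂ j, {X : Matrix (Fin n) (Fin p) ℂ | (Xᴴ * X) j j = 1} := by
      ext X; simp [OBset]
    rw [this]
    refine isClosed_iInter fun j => isClosed_eq ?_ continuous_const
    have h : Continuous fun X : Matrix (Fin n) (Fin p) ℂ => Xᴴ * X := by fun_prop
    exact h.matrix_elem j j
  · have h : colNormSq X j = 1 := by
      have := conjTranspose_mul_self_diag X j
      rw [hX j] at this
      exact_mod_cast this.symm
    have h2 : Complex.normSq (X i j) ≤ colNormSq X j :=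
      Finset.single_le_sum (f := fun i => Complex.normSq (X i j))
        (fun i _ => Complex.normSq_nonneg _) (Finset.mem_univ i)
    rw [h, Complex.normSq_eq_norm_sq] at h2
    rw [mem_closedBall_zero_iff]
    nlinarith [norm_nonneg (X i j)]

lemma continuous_gmu {n p : ℕ} (A : Matrix (Fin n) (Fin n) ℂ) (μ : ℝ) :
    Continuous (gmu A μ : Matrix (Fin n) (Fin p) ℂ → ℝ) := by
  have h1 : Continuous fun X : Matrix (Fin n) (Fin p) ℂ => Xᴴ * A * X := by fun_prop
  have h2 : Continuous fun X : Matrix (Fin n) (Fin p) ℂ => (Xᴴ * X) * (Xᴴ * X) := by fun_prop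
  exact (continuous_const.mul (Complex.continuous_re.comp h1.matrix_trace)).add
    (continuous_const.mul (Complex.continuous_re.comp h2.matrix_trace))

/-- `X = Q_p (I − (Λ_p − Λ̄_p)/μ)^{1/2} V^*` (with `V` unitary making
`X ∈ OB(n,p)`; such `V` exists) is a global minimizer of `g_μ` over `OB(n,p)`, with
value `(μ/4) tr((I + Λ̄_p/μ)² − Λ_p²/μ²)`; every local minimum equals this global
minimum. -/
theorem qTPM_global_minimizers {n p : ℕ} (hn : 0 < n) (hp : 0 < p) (hpn : p ≤ n)
    (A : Matrix (Fin n) (Fin n) ℂ) (hA : A.IsHermitian)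
    (hneg : ∀ z : Fin n → ℂ, z ≠ 0 → (star z ⬝ᵥ A.mulVec z).re < 0)
    (μ : ℝ) (hμ : |⨅ i, hA.eigenvalues i| < μ)
    (Q : Matrix (Fin n) (Fin p) ℂ) (V : Matrix (Fin p) (Fin p) ℂ)
    (hQ : Qᴴ * Q = 1)
    (hAQ : A * Q = Q * Matrix.diagonal (fun j : Fin p => (sortedEig hA (Fin.castLE hpn j) : ℂ)))
    (hV : Vᴴ * V = 1) (hV2 : V * Vᴴ = 1)
    (hOB : qtpmPoint hpn hA μ Q V ∈ OBset n p) :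
    (∃ V' : Matrix (Fin p) (Fin p) ℂ, V'ᴴ * V' = 1 ∧ V' * V'ᴴ = 1 ∧
      qtpmPoint hpn hA μ Q V' ∈ OBset n p) ∧
    gmu A μ (qtpmPoint hpn hA μ Q V) =
      (μ / 4) * ∑ j : Fin p,
        ((1 + ((∑ l : Fin p, sortedEig hA (Fin.castLE hpn l)) / p) / μ) ^ 2
          - (sortedEig hA (Fin.castLE hpn j)) ^ 2 / μ ^ 2) ∧
    (∀ Y ∈ OBset n p, gmu A μ (qtpmPoint hpn hA μ Q V) ≤ gmu A μ Y) ∧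
    (∀ Z ∈ OBset n p,
      (∃ δ > (0 : ℝ), ∀ Y ∈ OBset n p, frobNorm (Y - Z) < δ → gmu A μ Z ≤ gmu A μ Y) →
      gmu A μ Z = gmu A μ (qtpmPoint hpn hA μ Q V)) := by
  have hlow : ∀ i, -μ < hA.eigenvalues i := fun i =>
    (neg_lt_of_abs_lt hμ).trans_le (ciInf_le (Set.finite_range _).bddBelow i)
  have hμ0 : 0 < μ := (abs_nonneg _).trans_lt hμ
  have hX := gmu_qtpmPoint hp hpn hA hneg hμ0 hlow hQ hAQ hV
  have hloc : ∀ Z ∈ OBset n p, IsLocalMinimizer A μ Z →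
      gmu A μ Z = gmu A μ (qtpmPoint hpn hA μ Q V) := fun Z hZ hmin => by
    rw [hX, hmin.gmu_eq hp hpn hA hneg hμ0 hlow hZ]
  refine ⟨⟨V, hV, hV2, hOB⟩, hX, ?_, hloc⟩
  obtain ⟨Z, hZ, hmin⟩ := isCompact_OBset.exists_isMinOn ⟨_, hOB⟩
    (continuous_gmu A μ).continuousOn
  intro Y hY
  rw [← hloc Z hZ ⟨1, one_pos, fun W hW _ => hmin hW⟩]
  exact hmin hY
end
end

section
/- Let X ∈ OB(n,p) with X*X ≠ I, and let X = U Σ V^* be a singular value decomposition with U ∈ ℂ^{n×p} satisfying U*U = I, Σ ∈ ℝ^{p×p} diagonal with nonnegative entries (not necessarily ordered), and V ∈ ℂ^{p×p} unitary. Then there exist constants C > 0 and ε_0 > 0 such that for every ε ∈ (0, ε_0) and every diagonal matrix Σ̃ ∈ ℝ^{p×p} with nonnegative entries satisfying tr(Σ̃^2) = tr(Σ^2) and ‖Σ̃^2 − Σ^2‖_F ≤ ε, there exists a unitary matrix Ṽ ∈ ℂ^{p×p} such that X̃ := U Σ̃ Ṽ^* ∈ OB(n,p) and ‖X̃ − X‖_F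 ≤ C ε^{1/2}. -/
open Matrix Finset

noncomputable section

open scoped Matrix.Norms.Frobenius

section Helpers

variable {p : ℕ}

lemma intermediate_rotation (a b ρ s₀ : ℝ)
    (h : (1:ℝ) ∈ Set.uIcc ((1 - (-s₀) ^ 2) * a + (-s₀) ^ 2 * b + 2 * (-s₀) * √(1 - (-s₀) ^ 2) * ρ)
      ((1 - s₀ ^ 2) * a + s₀ ^ 2 * b + 2 * s₀ * √(1 - s₀ ^ 2) * ρ)) (hs₀ : 0 ≤ s₀) :
    ∃ s : ℝ, |s| ≤ s₀ ∧ (1 - s ^ 2) * a + s ^ 2 * b + 2 * s * √(1 - s ^ 2) * ρ = 1 := by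
  obtain ⟨s, hs, h1⟩ := intermediate_value_uIcc
    (f := fun s : ℝ => (1 - s ^ 2) * a + s ^ 2 * b + 2 * s * √(1 - s ^ 2) * ρ)
    (a := -s₀) (b := s₀) (by fun_prop) h
  rw [Set.uIcc_of_le (by linarith)] at hs
  exact ⟨s, abs_le.2 hs, h1⟩

lemma exists_rotation_of_gap {a b ρ t r : ℝ} (ht : 0 < t) (hr : 0 ≤ r) (ha : |a - 1| ≤ r ^ 2)
    (hab : (a - 1) * (b - 1) ≤ 0) (hb : t ≤ |b - 1|) :
    ∃ s : ℝ, s ^ 2 ≤ 1 ∧ |s| ≤ r / √t ∧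
      (1 - s ^ 2) * a + s ^ 2 * b + 2 * s * √(1 - s ^ 2) * ρ = 1 := by
  have hpos : 0 < |a - 1| + |b - 1| := by linarith [abs_nonneg (a - 1)]
  have hq : 0 ≤ |a - 1| / (|a - 1| + |b - 1|) := by positivity
  have hsq := Real.sq_sqrt hq
  set s₀ := √(|a - 1| / (|a - 1| + |b - 1|)) with hs₀
  have hs0 : 0 ≤ s₀ := Real.sqrt_nonneg _
  have hmid : (1 - s₀ ^ 2) * a + s₀ ^ 2 * b = 1 := by
    rw [hsq]
    field_simp
    rcases le_total 0 (a - 1) with h | h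
    · have h' : b - 1 ≤ 0 ∨ a - 1 = 0 := by
        by_contra! hc
        have : 0 < a - 1 := lt_of_le_of_ne h (Ne.symm hc.2)
        nlinarith
      rcases h' with h' | h'
      · rw [abs_of_nonneg h, abs_of_nonpos h']; ring
      · simp [h']; linear_combination |b-1| * h'
    · have h' : 0 ≤ b - 1 ∨ a - 1 = 0 := by
        by_contra! hc
        have : a - 1 < 0 := lt_of_le_of_ne h hc.2
        nlinarith
      rcases h' with h' | h'
      · rw [abs_of_nonneg h', abs_of_nonpos h]; ring
      · simp [h']; linear_combination |b-1| * h'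
  have hle : s₀ ≤ r / √t := by
    rw [hs₀, ← Real.sqrt_sq hr, ← Real.sqrt_div (sq_nonneg r)]
    apply Real.sqrt_le_sqrt
    have := abs_nonneg (a - 1)
    gcongr
    linarith
  have hone : s₀ ^ 2 ≤ 1 := by
    rw [hsq, div_le_one hpos]
    linarith [abs_nonneg (b - 1)]
  obtain ⟨s, hs, h1⟩ := intermediate_rotation a b ρ s₀ (by
    rw [neg_sq, hmid, Set.mem_uIcc]
    rcases le_total 0 (2 * s₀ * √(1 - s₀ ^ 2) * ρ) with h | h
    · left; constructor <;> linarith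
    · right; constructor <;> linarith) hs0
  refine ⟨s, ?_, hs.trans hle, h1⟩
  rw [← sq_abs]
  nlinarith [abs_nonneg s]

lemma exists_rotation_of_coupling {a ρ s₀ : ℝ} (hs₀ : 0 ≤ s₀) (hs₁ : s₀ ≤ 1 / 2)
    (ha : |a - 1| ≤ s₀ * ρ) :
    ∃ s : ℝ, |s| ≤ s₀ ∧ (1 - s ^ 2) * a + s ^ 2 * (2 - a) + 2 * s * √(1 - s ^ 2) * ρ = 1 := by
  refine intermediate_rotation a (2 - a) ρ s₀ ?_ hs₀
  have hc : 1 / 2 ≤ √(1 - s₀ ^ 2) := Real.le_sqrt_of_sq_le (by nlinarith)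
  have h0 : 0 ≤ s₀ * ρ := (abs_nonneg _).trans ha
  have h1 : s₀ * ρ ≤ 2 * s₀ * √(1 - s₀ ^ 2) * ρ := by nlinarith
  have h2 : |(a - 1) * (1 - 2 * s₀ ^ 2)| ≤ s₀ * ρ := by
    rw [abs_mul, abs_of_nonneg (a := 1 - 2 * s₀ ^ 2) (by nlinarith)]
    nlinarith [abs_nonneg (a - 1), sq_nonneg s₀]
  rw [abs_le] at h2
  rw [neg_sq, Set.mem_uIcc]
  left
  constructor <;> nlinarith

/-- The Rodrigues rotation `exp (θ K)` with `sin θ = s`, for a generator with `K³ = -K`. -/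
def rodrigues {p : ℕ} (K : Matrix (Fin p) (Fin p) ℂ) (s : ℝ) : Matrix (Fin p) (Fin p) ℂ :=
  1 + (s : ℂ) • K + ((1 - √(1 - s ^ 2) : ℝ) : ℂ) • (K * K)

/-- The skew-Hermitian generator of the rotations of the plane spanned by `x` and `y`. -/
def planeGen {p : ℕ} (x y : Fin p → ℂ) : Matrix (Fin p) (Fin p) ℂ :=
  vecMulVec y (star x) - vecMulVec x (star y)

lemma conjTranspose_rodrigues {K : Matrix (Fin p) (Fin p) ℂ} (hK : Kᴴ = -K) (s : ℝ) :
    (rodrigues K s)ᴴ = 1 - (s : ℂ) • K + ((1 - √(1 - s ^ 2) : ℝ) : ℂ) • (K * K) := by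
  simp only [rodrigues, conjTranspose_add, conjTranspose_one, conjTranspose_smul,
    conjTranspose_mul, hK, Complex.star_def, Complex.conj_ofReal]
  simp [sub_eq_add_neg]

lemma rodrigues_mul_conjTranspose {K : Matrix (Fin p) (Fin p) ℂ} (hK : Kᴴ = -K)
    (hK3 : K * K * K = -K) {s : ℝ} (hs : s ^ 2 ≤ 1) :
    rodrigues K s * (rodrigues K s)ᴴ = 1 := by
  have hc : (((1 - √(1 - s ^ 2) : ℝ) : ℂ) - 1) ^ 2 = 1 - (s : ℂ) ^ 2 := by
    norm_cast
    rw [show (1 - √(1 - s ^ 2) - 1) ^ 2 = √(1 - s ^ 2) ^ 2 by ring,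
      Real.sq_sqrt (by linarith)]
  rw [conjTranspose_rodrigues hK, rodrigues]
  generalize (((1 - √(1 - s ^ 2) : ℝ) : ℂ)) = c at hc
  have hK3' : K * (K * K) = -K := by rw [← mul_assoc, hK3]
  simp only [mul_add, add_mul, mul_sub, mul_one, one_mul, smul_mul_assoc, mul_smul_comm,
    mul_assoc, hK3', mul_neg]
  linear_combination (norm := module) -hc • (K * K)

lemma norm_one_sub_sqrt_le {s : ℝ} (hs : s ^ 2 ≤ 1) : |1 - √(1 - s ^ 2)| ≤ |s| := by
  have h1 : √(1 - s ^ 2) ≤ 1 := Real.sqrt_le_one.2 (by linarith [sq_nonneg s])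
  have h2 : 1 - |s| ≤ √(1 - s ^ 2) := by
    apply Real.le_sqrt_of_sq_le
    have h := abs_nonneg s
    have : |s| ≤ 1 := by rwa [sq_le_one_iff_abs_le_one] at hs
    nlinarith [sq_abs s]
  rw [abs_of_nonneg (by linarith)]
  linarith

lemma norm_rodrigues_sub_one_le (K : Matrix (Fin p) (Fin p) ℂ) {s : ℝ} (hs : s ^ 2 ≤ 1) :
    ‖rodrigues K s - 1‖ ≤ (‖K‖ + ‖K * K‖) * |s| := by
  have h : rodrigues K s - 1 = (s : ℂ) • K + ((1 - √(1 - s ^ 2) : ℝ) : ℂ) • (K * K) := by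
    rw [rodrigues]; abel
  rw [h]
  refine (norm_add_le _ _).trans ?_
  rw [norm_smul, norm_smul, Complex.norm_real, Complex.norm_real, Real.norm_eq_abs,
    Real.norm_eq_abs]
  nlinarith [norm_one_sub_sqrt_le hs, norm_nonneg (K * K)]

lemma conjTranspose_planeGen (x y : Fin p → ℂ) : (planeGen x y)ᴴ = -planeGen x y := by
  simp [planeGen, conjTranspose_vecMulVec]

lemma planeGen_mulVec (x y z : Fin p → ℂ) :
    planeGen x y *ᵥ z = (star x ⬝ᵥ z) • y - (star y ⬝ᵥ z) • x := by
  simp [planeGen, sub_mulVec, vecMulVec_mulVec]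

lemma planeGen_pow_three {x y : Fin p → ℂ} (hx : star x ⬝ᵥ x = 1) (hy : star y ⬝ᵥ y = 1)
    (hxy : star x ⬝ᵥ y = 0) : 
    planeGen x y * planeGen x y * planeGen x y = -planeGen x y := by
  have hyx : star y ⬝ᵥ x = 0 := by
    rw [← star_star (star y ⬝ᵥ x), ← star_dotProduct_star]; simp [hxy]
  have h2 : planeGen x y * planeGen x y = -(vecMulVec x (star x) + vecMulVec y (star y)) := by
    simp [planeGen, sub_mul, mul_sub, vecMulVec_mul_vecMulVec, hx, hy, hxy, hyx]
    abel
  rw [h2]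
  simp [planeGen, add_mul, mul_sub, vecMulVec_mul_vecMulVec, hx, hy, hxy, hyx]
  abel

lemma conjTranspose_rodrigues_mulVec_left {x y : Fin p → ℂ} (hx : star x ⬝ᵥ x = 1)
    (hy : star y ⬝ᵥ y = 1) (hxy : star x ⬝ᵥ y = 0) (s : ℝ) :
    (rodrigues (planeGen x y) s)ᴴ *ᵥ x = (√(1 - s ^ 2) : ℂ) • x - (s : ℂ) • y := by
  have hyx : star y ⬝ᵥ x = 0 := by
    rw [← star_star (star y ⬝ᵥ x), ← star_dotProduct_star]; simp [hxy]
  have h1 : planeGen x y *ᵥ x = y := by simp [planeGen_mulVec, hx, hyx]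
  have h2 : planeGen x y *ᵥ y = -x := by simp [planeGen_mulVec, hy, hxy]
  rw [conjTranspose_rodrigues (conjTranspose_planeGen x y), add_mulVec, sub_mulVec, smul_mulVec,
    smul_mulVec, ← mulVec_mulVec, h1, h2, one_mulVec]
  push_cast
  module

lemma conjTranspose_rodrigues_mulVec_of_orthogonal {x y z : Fin p → ℂ} (hx : star x ⬝ᵥ z = 0)
    (hy : star y ⬝ᵥ z = 0) (s : ℝ) :
    (rodrigues (planeGen x y) s)ᴴ *ᵥ z = z := by
  have h1 : planeGen x y *ᵥ z = 0 := by simp [planeGen_mulVec, hx, hy]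
  rw [conjTranspose_rodrigues (conjTranspose_planeGen x y), add_mulVec, sub_mulVec, smul_mulVec,
    smul_mulVec, ← mulVec_mulVec, h1]
  simp

lemma conj_apply_diag (R B : Matrix (Fin p) (Fin p) ℂ) (j : Fin p) :
    (R * B * Rᴴ) j j = star (Rᴴ *ᵥ Pi.single j 1) ⬝ᵥ (B *ᵥ (Rᴴ *ᵥ Pi.single j 1)) := by
  rw [star_mulVec, conjTranspose_conjTranspose, ← dotProduct_mulVec, mulVec_mulVec, mulVec_mulVec,
    mul_assoc, mulVec_single_one]
  simp [col_apply]

lemma conj_rodrigues_diag_re {B : Matrix (Fin p) (Fin p) ℂ} (hB : B.IsHermitian) {i : Fin p}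
    {y : Fin p → ℂ} (hy : star y ⬝ᵥ y = 1) (hyi : y i = 0) {s : ℝ} (hs : s ^ 2 ≤ 1) :
    ((rodrigues (planeGen (Pi.single i 1) y) s * B *
      (rodrigues (planeGen (Pi.single i 1) y) s)ᴴ) i i).re =
      (1 - s ^ 2) * (B i i).re + s ^ 2 * (star y ⬝ᵥ (B *ᵥ y)).re +
        2 * s * √(1 - s ^ 2) * (-(star y ⬝ᵥ (B *ᵥ Pi.single i 1)).re) := by
  have hsym : star (Pi.single i 1 : Fin p → ℂ) ⬝ᵥ (B *ᵥ y) =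
      star (star y ⬝ᵥ (B *ᵥ Pi.single i 1)) := by
    conv_rhs => rw [← star_dotProduct_star, star_star, star_mulVec, hB.eq]
    rw [← dotProduct_mulVec]
  have hBii : star (Pi.single i 1 : Fin p → ℂ) ⬝ᵥ (B *ᵥ Pi.single i 1) = B i i := by
    simp [col_apply]
  have hsq := Real.sq_sqrt (sub_nonneg.2 hs)
  rw [conj_apply_diag, conjTranspose_rodrigues_mulVec_left (by simp) hy
    (by simp [hyi])]
  simp only [mulVec_sub, mulVec_smul, star_sub, star_smul, sub_dotProduct, dotProduct_sub,
    smul_dotProduct, dotProduct_smul, hsym, hBii, smul_eq_mul, Complex.star_def,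
    Complex.conj_ofReal, Complex.sub_re, Complex.re_ofReal_mul, Complex.conj_re]
  linear_combination (B i i).re * hsq

lemma diag_eq_one_of_re_eq_one {B : Matrix (Fin p) (Fin p) ℂ} (hB : B.IsHermitian) {i : Fin p}
    (h : (B i i).re = 1) : B i i = 1 := by
  have := Complex.conj_eq_iff_re.1 (hB.apply i i)
  rw [← this, h, Complex.ofReal_one]


lemma exists_unit_vector_quadratic {G : Matrix (Fin p) (Fin p) ℂ} (hG : G.IsHermitian)
    {k l : Fin p} (hkl : k ≠ l) (hk : G k k = 1) (hl : G l l = 1) (hg : G k l ≠ 0) {τ : ℝ}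
    (hτ : τ ^ 2 = 1) :
    ∃ y : Fin p → ℂ, star y ⬝ᵥ y = 1 ∧ (∀ j, j ≠ k → j ≠ l → y j = 0) ∧
      (star y ⬝ᵥ (G *ᵥ y)).re = 1 + τ * ‖G k l‖ := by
  have hlk : G l k = star (G k l) := (hG.apply l k).symm
  have hn : (‖G k l‖ : ℂ) ≠ 0 := by simpa using hg
  have hn2 : G k l * (starRingEnd ℂ) (G k l) = (‖G k l‖ : ℂ) ^ 2 := by
    rw [Complex.mul_conj, Complex.normSq_eq_norm_sq]; push_cast; rfl
  have h2 : ((√2 : ℝ) : ℂ) ^ 2 = 2 := by norm_cast; simp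
  have h20 : ((√2 : ℝ) : ℂ) ≠ 0 := by simp
  have hτ' : (τ : ℂ) ^ 2 = 1 := by exact_mod_cast hτ
  refine ⟨Pi.single k ((√2 : ℝ) : ℂ)⁻¹ +
    Pi.single l (τ * star (G k l) / ‖G k l‖ * ((√2 : ℝ) : ℂ)⁻¹), ?_, ?_, ?_⟩
  · simp [hkl, hkl.symm]
    field_simp
    linear_combination (‖G k l‖ : ℂ) ^ 2 * hτ' + (τ : ℂ) ^ 2 * hn2 - (‖G k l‖ : ℂ) ^ 2 * h2
  · intro j h1 h2
    simp [h1, h2]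
  · suffices h : (star (Pi.single k ((√2 : ℝ) : ℂ)⁻¹ +
        Pi.single l (τ * star (G k l) / ‖G k l‖ * ((√2 : ℝ) : ℂ)⁻¹)) ⬝ᵥ (G *ᵥ
        (Pi.single k ((√2 : ℝ) : ℂ)⁻¹ +
        Pi.single l (τ * star (G k l) / ‖G k l‖ * ((√2 : ℝ) : ℂ)⁻¹)))) =
        ((1 + τ * ‖G k l‖ : ℝ) : ℂ) by
      rw [h, Complex.ofReal_re]
    simp [add_dotProduct, mulVec_add, hk, hl, hlk]
    field_simp
    rw [h2]
    linear_combination (2 * τ * (‖G k l‖ : ℂ) + τ ^ 2) * hn2 + (‖G k l‖ : ℂ) ^ 2 * hτ'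

lemma continuous_quadratic_re (x y : Fin p → ℂ) :
    Continuous fun B : Matrix (Fin p) (Fin p) ℂ => (star x ⬝ᵥ (B *ᵥ y)).re := by
  fun_prop

lemma exists_near_of_continuous {f : Matrix (Fin p) (Fin p) ℂ → ℝ} (hf : Continuous f)
    (G : Matrix (Fin p) (Fin p) ℂ) {δ : ℝ} (hδ : 0 < δ) :
    ∃ η > 0, ∀ B, ‖B - G‖ < η → |f B - f G| < δ := by
  obtain ⟨η, hη, h⟩ := Metric.continuous_iff.1 hf G δ hδ
  exact ⟨η, hη, fun B hB => h B (by rwa [dist_eq_norm])⟩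

lemma exists_unitary_fix_diag {G : Matrix (Fin p) (Fin p) ℂ} (hG : G.IsHermitian)
    {k l : Fin p} (hkl : k ≠ l) (hk : G k k = 1) (hl : G l l = 1) (hg : G k l ≠ 0)
    {i : Fin p} (hik : i ≠ k) (hil : i ≠ l) :
    ∃ D ≥ (0 : ℝ), ∃ η > (0 : ℝ), ∀ B : Matrix (Fin p) (Fin p) ℂ, B.IsHermitian → ‖B - G‖ < η →
      ∀ r ≥ (0 : ℝ), |(B i i).re - 1| ≤ r ^ 2 →
        ∃ R : Matrix (Fin p) (Fin p) ℂ, R * Rᴴ = 1 ∧ ‖R - 1‖ ≤ D * r ∧ (R * B * Rᴴ) i i = 1 ∧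
          ∀ j, j ≠ i → j ≠ k → j ≠ l → (R * B * Rᴴ) j j = B j j := by
  have hpos : 0 < ‖G k l‖ / 2 := by positivity
  have key : ∀ τ : ℝ, τ ^ 2 = 1 →
      ∃ D ≥ (0 : ℝ), ∃ η > (0 : ℝ), ∀ B : Matrix (Fin p) (Fin p) ℂ, B.IsHermitian → ‖B - G‖ < η →
      ∀ r ≥ (0 : ℝ), |(B i i).re - 1| ≤ r ^ 2 → ((B i i).re - 1) * τ ≤ 0 →
        ∃ R : Matrix (Fin p) (Fin p) ℂ, R * Rᴴ = 1 ∧ ‖R - 1‖ ≤ D * r ∧ (R * B * Rᴴ) i i = 1 ∧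
          ∀ j, j ≠ i → j ≠ k → j ≠ l → (R * B * Rᴴ) j j = B j j := by
    intro τ hτ
    obtain ⟨y, hy, hy0, hyG⟩ := exists_unit_vector_quadratic hG hkl hk hl hg hτ
    obtain ⟨η, hη, hnear⟩ := exists_near_of_continuous (continuous_quadratic_re y y) G hpos
    set K := planeGen (Pi.single i 1) y with hKdef
    have hyi := hy0 i hik hil
    refine ⟨(‖K‖ + ‖K * K‖) / √(‖G k l‖ / 2), by positivity, η, hη, ?_⟩
    intro B hB hBG r hr hBr hsign
    have hQ := abs_lt.1 (hnear B hBG)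
    rw [hyG] at hQ
    set Q := (star y ⬝ᵥ (B *ᵥ y)).re
    have hτQ : ‖G k l‖ / 2 ≤ τ * (Q - 1) := by
      rcases mul_self_eq_one_iff.1 ((sq τ).symm.trans hτ) with rfl | rfl <;> linarith [hQ.1, hQ.2]
    have hgap : ‖G k l‖ / 2 ≤ |Q - 1| := by
      have : |τ| = 1 := by
        rcases mul_self_eq_one_iff.1 ((sq τ).symm.trans hτ) with rfl | rfl <;> simp
      calc _ ≤ τ * (Q - 1) := hτQ
        _ ≤ |τ * (Q - 1)| := le_abs_self _
        _ = _ := by rw [abs_mul, this, one_mul]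
    have hopp : ((B i i).re - 1) * (Q - 1) ≤ 0 := by
      have h1 : (((B i i).re - 1) * τ) * (τ * (Q - 1)) ≤ 0 :=
        mul_nonpos_of_nonpos_of_nonneg hsign (hpos.le.trans hτQ)
      calc _ = τ ^ 2 * (((B i i).re - 1) * (Q - 1)) := by rw [hτ, one_mul]
        _ = (((B i i).re - 1) * τ) * (τ * (Q - 1)) := by ring
        _ ≤ 0 := h1
    obtain ⟨s, hs1, hsr, hs⟩ := exists_rotation_of_gap
      (ρ := -(star y ⬝ᵥ (B *ᵥ Pi.single i 1)).re) hpos hr hBr hopp hgap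
    refine ⟨rodrigues K s, rodrigues_mul_conjTranspose (conjTranspose_planeGen _ _)
      (planeGen_pow_three (by simp) hy (by simp [hyi])) hs1, ?_, ?_, ?_⟩
    · refine (norm_rodrigues_sub_one_le K hs1).trans ?_
      rw [div_mul_eq_mul_div, mul_div_assoc]
      gcongr
    · refine diag_eq_one_of_re_eq_one (isHermitian_mul_mul_conjTranspose _ hB) ?_
      rw [conj_rodrigues_diag_re hB hy hyi hs1, hs]
    · intro j hji hjk hjl
      rw [conj_apply_diag, conjTranspose_rodrigues_mulVec_of_orthogonal (by simp [hji])
        (by simp [hy0 j hjk hjl])]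
      simp [col_apply]
  obtain ⟨D₁, hD₁, η₁, hη₁, h₁⟩ := key 1 (by norm_num)
  obtain ⟨D₂, hD₂, η₂, hη₂, h₂⟩ := key (-1) (by norm_num)
  refine ⟨max D₁ D₂, le_max_of_le_left hD₁, min η₁ η₂, lt_min hη₁ hη₂, ?_⟩
  intro B hB hBG r hr hBr
  rcases le_total ((B i i).re - 1) 0 with h | h
  · obtain ⟨R, hR, hR1, hR2⟩ := h₁ B hB (hBG.trans_le (min_le_left _ _)) r hr hBr (by linarith)
    exact ⟨R, hR, hR1.trans (by gcongr; exact le_max_left _ _), hR2⟩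
  · obtain ⟨R, hR, hR1, hR2⟩ := h₂ B hB (hBG.trans_le (min_le_right _ _)) r hr hBr (by linarith)
    exact ⟨R, hR, hR1.trans (by gcongr; exact le_max_right _ _), hR2⟩

lemma norm_conj_sub_le {W A G : Matrix (Fin p) (Fin p) ℂ} {C r : ℝ} (hC : 0 ≤ C)
    (hr : 0 ≤ r) (hr1 : r ≤ 1) (hW : ‖W - 1‖ ≤ C * r) (hA : ‖A - G‖ ≤ r ^ 2) :
    ‖W * A * Wᴴ - G‖ ≤
      (C * (‖G‖ + 1) * (‖(1 : Matrix (Fin p) (Fin p) ℂ)‖ + C) + (‖G‖ + 1) * C + 1) * r := by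
  have hWs : ‖Wᴴ - 1‖ ≤ C * r := by
    rw [← frobenius_norm_conjTranspose]; simpa using hW
  have hWn : ‖Wᴴ‖ ≤ ‖(1 : Matrix (Fin p) (Fin p) ℂ)‖ + C := by
    calc ‖Wᴴ‖ = ‖1 + (Wᴴ - 1)‖ := by rw [add_sub_cancel]
      _ ≤ ‖(1 : Matrix (Fin p) (Fin p) ℂ)‖ + ‖Wᴴ - 1‖ := norm_add_le _ _
      _ ≤ _ := by gcongr; exact hWs.trans (mul_le_of_le_one_right hC hr1)
  have hr2 : r ^ 2 ≤ r := by nlinarith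
  have hAn : ‖A‖ ≤ ‖G‖ + 1 := by
    calc ‖A‖ = ‖G + (A - G)‖ := by rw [add_sub_cancel]
      _ ≤ ‖G‖ + ‖A - G‖ := norm_add_le _ _
      _ ≤ _ := by gcongr; linarith
  calc ‖W * A * Wᴴ - G‖ = ‖(W - 1) * A * Wᴴ + A * (Wᴴ - 1) + (A - G)‖ := by
        congr 1; noncomm_ring
    _ ≤ ‖W - 1‖ * ‖A‖ * ‖Wᴴ‖ + ‖A‖ * ‖Wᴴ - 1‖ + ‖A - G‖ := by
        refine norm_add₃_le.trans ?_
        gcongr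
        · exact (norm_mul_le _ _).trans (by gcongr; exact norm_mul_le _ _)
        · exact norm_mul_le _ _
    _ ≤ (C * r) * (‖G‖ + 1) * (‖(1 : Matrix (Fin p) (Fin p) ℂ)‖ + C) +
          (‖G‖ + 1) * (C * r) + r := by
        gcongr; linarith
    _ = _ := by ring

lemma norm_mul_sub_one_le {R W : Matrix (Fin p) (Fin p) ℂ} {D C r : ℝ} (hD : 0 ≤ D)
    (hC : 0 ≤ C) (hr : 0 ≤ r) (hr1 : r ≤ 1) (hR : ‖R - 1‖ ≤ D * r) (hW : ‖W - 1‖ ≤ C * r) :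
    ‖R * W - 1‖ ≤ (D * (‖(1 : Matrix (Fin p) (Fin p) ℂ)‖ + C) + C) * r := by
  have hWn : ‖W‖ ≤ ‖(1 : Matrix (Fin p) (Fin p) ℂ)‖ + C := by
    calc ‖W‖ = ‖1 + (W - 1)‖ := by rw [add_sub_cancel]
      _ ≤ ‖(1 : Matrix (Fin p) (Fin p) ℂ)‖ + ‖W - 1‖ := norm_add_le _ _
      _ ≤ _ := by gcongr; exact hW.trans (mul_le_of_le_one_right hC hr1)
  calc ‖R * W - 1‖ = ‖(R - 1) * W + (W - 1)‖ := by congr 1; noncomm_ring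
    _ ≤ ‖R - 1‖ * ‖W‖ + ‖W - 1‖ := (norm_add_le _ _).trans (by gcongr; exact norm_mul_le _ _)
    _ ≤ (D * r) * (‖(1 : Matrix (Fin p) (Fin p) ℂ)‖ + C) + C * r := by gcongr
    _ = _ := by ring

lemma norm_entry_le_frobenius (A : Matrix (Fin p) (Fin p) ℂ) (i j : Fin p) : ‖A i j‖ ≤ ‖A‖ := by
  rw [frobenius_norm_def, ← Real.sqrt_eq_rpow]
  apply Real.le_sqrt_of_sq_le
  calc ‖A i j‖ ^ 2 ≤ ∑ j, ‖A i j‖ ^ (2 : ℝ) := by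
        simpa using Finset.single_le_sum (f := fun j => ‖A i j‖ ^ (2 : ℝ))
          (fun _ _ => by positivity) (Finset.mem_univ j)
    _ ≤ _ := Finset.single_le_sum (f := fun i => ∑ j, ‖A i j‖ ^ (2 : ℝ))
          (fun _ _ => by positivity) (Finset.mem_univ i)

lemma abs_diag_re_sub_one_le {A G : Matrix (Fin p) (Fin p) ℂ} {i : Fin p} (hG : G i i = 1) :
    |(A i i).re - 1| ≤ ‖A - G‖ := by
  calc |(A i i).re - 1| = |((A - G) i i).re| := by simp [hG]
    _ ≤ ‖(A - G) i i‖ := Complex.abs_re_le_norm _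
    _ ≤ _ := norm_entry_le_frobenius _ _ _

lemma exists_unitary_fix_diag_finset {G : Matrix (Fin p) (Fin p) ℂ} (hG : G.IsHermitian)
    (hdiag : ∀ j, G j j = 1) {k l : Fin p} (hkl : k ≠ l) (hg : G k l ≠ 0) (S : Finset (Fin p))
    (hkS : k ∉ S) (hlS : l ∉ S) :
    ∃ C ≥ (0 : ℝ), ∃ r₀ > (0 : ℝ), ∀ A : Matrix (Fin p) (Fin p) ℂ, A.IsHermitian →
      ∀ r ≥ (0 : ℝ), r < r₀ → ‖A - G‖ ≤ r ^ 2 →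
        ∃ W : Matrix (Fin p) (Fin p) ℂ, W * Wᴴ = 1 ∧ ‖W - 1‖ ≤ C * r ∧
          (∀ i ∈ S, (W * A * Wᴴ) i i = 1) ∧
          ∀ i ∉ S, i ≠ k → i ≠ l → (W * A * Wᴴ) i i = A i i := by
  induction S using Finset.induction_on with
  | empty =>
    refine ⟨0, le_rfl, 1, one_pos, fun A _ r _ _ _ => ⟨1, by simp, by simp, by simp, by simp⟩⟩
  | insert i S hiS ih =>
    simp only [Finset.mem_insert, not_or] at hkS hlS
    obtain ⟨C, hC, r₀, hr₀, h⟩ := ih hkS.2 hlS.2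
    obtain ⟨D, hD, η, hη, hfix⟩ := exists_unitary_fix_diag hG hkl (hdiag k) (hdiag l) hg
      (Ne.symm hkS.1) (Ne.symm hlS.1)
    set L := C * (‖G‖ + 1) * (‖(1 : Matrix (Fin p) (Fin p) ℂ)‖ + C) + (‖G‖ + 1) * C + 1 with hL
    have hLpos : 0 < L := by positivity
    refine ⟨D * (‖(1 : Matrix (Fin p) (Fin p) ℂ)‖ + C) + C, by positivity,
      min (min r₀ 1) (η / L), by positivity, ?_⟩
    intro A hA r hr hrlt hAG
    obtain ⟨⟨hr1, hr2⟩, hr3⟩ := by simpa only [lt_min_iff] using hrlt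
    obtain ⟨W, hW, hW1, hWS, hWn⟩ := h A hA r hr hr1 hAG
    have hBG : ‖W * A * Wᴴ - G‖ < η :=
      (norm_conj_sub_le hC hr hr2.le hW1 hAG).trans_lt (by rwa [lt_div_iff₀' hLpos] at hr3)
    obtain ⟨R, hR, hR1, hRi, hRn⟩ := hfix _ (isHermitian_mul_mul_conjTranspose W hA) hBG r hr (by
      rw [hWn i hiS (Ne.symm hkS.1) (Ne.symm hlS.1)]
      exact (abs_diag_re_sub_one_le (hdiag i)).trans hAG)
    have hconj : R * W * A * (R * W)ᴴ = R * (W * A * Wᴴ) * Rᴴ := by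
      simp only [conjTranspose_mul, mul_assoc]
    refine ⟨R * W, ?_, norm_mul_sub_one_le hD hC hr hr2.le hR1 hW1, ?_, ?_⟩
    · rw [conjTranspose_mul, mul_assoc, ← mul_assoc W, hW, one_mul, hR]
    · intro j hj
      rw [hconj]
      rcases Finset.mem_insert.1 hj with rfl | hj
      · exact hRi
      · rw [hRn j (fun h => hiS (h ▸ hj)) (fun h => hkS.2 (h ▸ hj)) (fun h => hlS.2 (h ▸ hj)),
          hWS j hj]
    · intro j hj hjk hjl
      rw [Finset.mem_insert, not_or] at hj
      rw [hconj, hRn j hj.1 hjk hjl, hWn j hj.2 hjk hjl]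

lemma trace_conj_eq {W A : Matrix (Fin p) (Fin p) ℂ} (hW : W * Wᴴ = 1) :
    (W * A * Wᴴ).trace = A.trace := by
  rw [trace_mul_comm, ← mul_assoc, mul_eq_one_comm.1 hW, one_mul]

lemma sum_diag_sub_one {A : Matrix (Fin p) (Fin p) ℂ} (hA : A.trace = p) :
    ∑ j, (A j j - 1) = 0 := by
  rw [Finset.sum_sub_distrib]
  simpa [sub_eq_zero, trace] using hA

/-- A Hermitian matrix near a non-identity matrix `G` with unit diagonal, and of the same trace,
is conjugate to one with unit diagonal by a unitary close to the identity. -/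
lemma exists_unitary_diag_eq_one {G : Matrix (Fin p) (Fin p) ℂ} (hG : G.IsHermitian)
    (hdiag : ∀ j, G j j = 1) {k l : Fin p} (hkl : k ≠ l) (hg : G k l ≠ 0) :
    ∃ C ≥ (0 : ℝ), ∃ r₀ > (0 : ℝ), ∀ A : Matrix (Fin p) (Fin p) ℂ, A.IsHermitian →
      A.trace = p → ∀ r ≥ (0 : ℝ), r < r₀ → ‖A - G‖ ≤ r ^ 2 →
        ∃ W : Matrix (Fin p) (Fin p) ℂ, W * Wᴴ = 1 ∧ ‖W - 1‖ ≤ C * r ∧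
          ∀ i, (W * A * Wᴴ) i i = 1 := by
  obtain ⟨C, hC, r₀, hr₀, h⟩ := exists_unitary_fix_diag_finset hG hdiag hkl hg
    (Finset.univ \ {k, l}) (by simp) (by simp)
  have hgpos : 0 < ‖G k l‖ := norm_pos_iff.2 hg
  have hgn : (‖G k l‖ : ℂ) ≠ 0 := by simpa using hg
  have hn2 : G k l * (starRingEnd ℂ) (G k l) = (‖G k l‖ : ℂ) ^ 2 := by
    rw [Complex.mul_conj, Complex.normSq_eq_norm_sq]; push_cast; rfl
  set φ : ℂ := -(star (G k l) / ‖G k l‖) with hφ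
  have hφ1 : star φ * φ = 1 := by
    simp [hφ]
    field_simp
    exact hn2
  set y : Fin p → ℂ := Pi.single l φ with hydef
  have hy : star y ⬝ᵥ y = 1 := by simpa [hydef, mul_comm] using hφ1
  have hyk : y k = 0 := by simp [hydef, hkl]
  have hyG : (star y ⬝ᵥ (G *ᵥ Pi.single k 1)).re = -‖G k l‖ := by
    have : star y ⬝ᵥ (G *ᵥ Pi.single k 1) = ((-‖G k l‖ : ℝ) : ℂ) := by
      have hlk : G l k = star (G k l) := (hG.apply l k).symm
      simp [hydef, col_apply, hlk, hφ]
      field_simp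
      exact hn2
    rw [this, Complex.ofReal_re]
  obtain ⟨η, hη, hnear⟩ := exists_near_of_continuous
    (continuous_quadratic_re y (Pi.single k 1)) G (half_pos hgpos)
  set L := C * (‖G‖ + 1) * (‖(1 : Matrix (Fin p) (Fin p) ℂ)‖ + C) + (‖G‖ + 1) * C + 1 with hL
  have hLpos : 0 < L := by positivity
  set K := planeGen (Pi.single k 1) y with hKdef
  set D := (‖K‖ + ‖K * K‖) * (L / (‖G k l‖ / 2)) with hDdef
  have hD : 0 ≤ D := by positivity
  refine ⟨D * (‖(1 : Matrix (Fin p) (Fin p) ℂ)‖ + C) + C, by positivity,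
    min (min r₀ 1) (min (η / L) (‖G k l‖ / 4 / L)), by positivity, ?_⟩
  intro A hA htr r hr hrlt hAG
  obtain ⟨⟨hr1, hr2⟩, hr3, hr4⟩ := by simpa only [lt_min_iff] using hrlt
  rw [lt_div_iff₀' hLpos] at hr3 hr4
  obtain ⟨W, hW, hW1, hWS, -⟩ := h A hA r hr hr1 hAG
  have hBL := norm_conj_sub_le hC hr hr2.le hW1 hAG
  rw [← hL] at hBL
  have hB := isHermitian_mul_mul_conjTranspose W hA
  have htrB := (trace_conj_eq (A := A) hW).trans htr
  have hdiagB : ∀ j, j ≠ k → j ≠ l → (W * A * Wᴴ) j j = 1 := fun j hjk hjl =>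
    hWS j (by simp [hjk, hjl])
  set B := W * A * Wᴴ with hBdef
  have hll : (B l l).re = 2 - (B k k).re := by
    have hsum := sum_diag_sub_one htrB
    rw [Fintype.sum_eq_add k l hkl (fun j hj => by rw [hdiagB j hj.1 hj.2, sub_self])] at hsum
    have := congrArg Complex.re hsum
    simp at this
    linarith
  have hyB : (star y ⬝ᵥ (B *ᵥ y)).re = 2 - (B k k).re := by
    have : star y ⬝ᵥ (B *ᵥ y) = B l l := by
      have h1 : y = φ • Pi.single l 1 := by simp [hydef, ← Pi.single_smul]
      rw [h1, mulVec_smul, star_smul, smul_dotProduct, dotProduct_smul, smul_smul, hφ1]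
      simp [col_apply]
    rw [this, hll]
  have hρ : ‖G k l‖ / 2 ≤ -(star y ⬝ᵥ (B *ᵥ Pi.single k 1)).re := by
    have := abs_lt.1 (hnear B (hBL.trans_lt hr3))
    rw [hyG] at this
    linarith [this.2]
  have hs₀ : 0 ≤ L * r / (‖G k l‖ / 2) := by positivity
  obtain ⟨s, hs, hs1⟩ := exists_rotation_of_coupling (a := (B k k).re)
    (ρ := -(star y ⬝ᵥ (B *ᵥ Pi.single k 1)).re) hs₀
    (by rw [div_le_iff₀ (half_pos hgpos)]; linarith) (by
      calc |(B k k).re - 1| ≤ ‖B - G‖ := abs_diag_re_sub_one_le (hdiag k)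
        _ ≤ L * r := hBL
        _ = L * r / (‖G k l‖ / 2) * (‖G k l‖ / 2) := by field_simp
        _ ≤ _ := by gcongr)
  have hsle : s ^ 2 ≤ 1 := by
    rw [sq_le_one_iff_abs_le_one]
    refine hs.trans ?_
    rw [div_le_iff₀ (half_pos hgpos)]
    linarith
  have hR : rodrigues K s * (rodrigues K s)ᴴ = 1 :=
    rodrigues_mul_conjTranspose (conjTranspose_planeGen _ _)
      (planeGen_pow_three (by simp) hy (by simp [hyk])) hsle
  have hR1 : ‖rodrigues K s - 1‖ ≤ D * r := by
    refine (norm_rodrigues_sub_one_le K hsle).trans ?_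
    rw [hDdef, mul_assoc, div_mul_eq_mul_div]
    gcongr
  have hkk : (rodrigues K s * B * (rodrigues K s)ᴴ) k k = 1 := by
    refine diag_eq_one_of_re_eq_one (isHermitian_mul_mul_conjTranspose _ hB) ?_
    rw [conj_rodrigues_diag_re hB hy hyk hsle, hyB, hs1]
  have hother : ∀ j, j ≠ l → (rodrigues K s * B * (rodrigues K s)ᴴ) j j = 1 := by
    intro j hjl
    rcases eq_or_ne j k with rfl | hjk
    · exact hkk
    · rw [conj_apply_diag, conjTranspose_rodrigues_mulVec_of_orthogonal (by simp [hjk])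
        (by simp [hydef, hjl])]
      simp [col_apply, hdiagB j hjk hjl]
  have hconj : rodrigues K s * W * A * (rodrigues K s * W)ᴴ =
      rodrigues K s * B * (rodrigues K s)ᴴ := by
    simp only [hBdef, conjTranspose_mul, mul_assoc]
  refine ⟨rodrigues K s * W, ?_, norm_mul_sub_one_le hD hC hr hr2.le hR1 hW1, ?_⟩
  · rw [conjTranspose_mul, mul_assoc, ← mul_assoc W, hW, one_mul, hR]
  · intro j
    rw [hconj]
    rcases eq_or_ne j l with rfl | hjl
    · have hsum := sum_diag_sub_one ((trace_conj_eq (A := B) hR).trans htrB)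
      rw [Fintype.sum_eq_single j (fun i hi => by rw [hother i hi, sub_self])] at hsum
      exact sub_eq_zero.1 hsum
    · exact hother j hjl

lemma frobNorm_eq_norm {n : ℕ} (X : Matrix (Fin n) (Fin p) ℂ) : frobNorm X = ‖X‖ := by
  rw [frobNorm, frobenius_norm_def, ← Real.sqrt_eq_rpow]
  simp [Complex.normSq_eq_norm_sq]

lemma norm_diagonal_ofReal (d : Fin p → ℝ) :
    ‖diagonal (fun j => (d j : ℂ))‖ = √(∑ j, d j ^ 2) := by
  rw [frobenius_norm_diagonal, EuclideanSpace.norm_eq]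
  simp

lemma sum_sub_sq_le {σ σ' : Fin p → ℝ} {ε : ℝ} (hσ : ∀ j, 0 ≤ σ j) (hσ' : ∀ j, 0 ≤ σ' j)
    (h : √(∑ j, (σ' j ^ 2 - σ j ^ 2) ^ 2) ≤ ε) : ∑ j, (σ' j - σ j) ^ 2 ≤ p * ε := by
  have hj : ∀ j, (σ' j - σ j) ^ 2 ≤ ε := by
    intro j
    calc (σ' j - σ j) ^ 2 = |σ' j - σ j| * |σ' j - σ j| := by rw [← sq, sq_abs]
      _ ≤ |σ' j - σ j| * |σ' j + σ j| := by
          gcongr 1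
          exact abs_le_abs (by linarith [hσ j]) (by linarith [hσ' j])
      _ = √((σ' j ^ 2 - σ j ^ 2) ^ 2) := by rw [← abs_mul, Real.sqrt_sq_eq_abs]; congr 1; ring
      _ ≤ √(∑ j, (σ' j ^ 2 - σ j ^ 2) ^ 2) := Real.sqrt_le_sqrt
          (Finset.single_le_sum (f := fun j => (σ' j ^ 2 - σ j ^ 2) ^ 2)
            (fun _ _ => sq_nonneg _) (Finset.mem_univ j))
      _ ≤ ε := h
  simpa using Finset.sum_le_sum fun j (_ : j ∈ Finset.univ) => hj j

lemma gram_eq {n : ℕ} {U : Matrix (Fin n) (Fin p) ℂ} (hU : Uᴴ * U = 1) (σ : Fin p → ℝ)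
    (V : Matrix (Fin p) (Fin p) ℂ) :
    (U * diagonal (fun j => (σ j : ℂ)) * Vᴴ)ᴴ * (U * diagonal (fun j => (σ j : ℂ)) * Vᴴ) =
      V * diagonal (fun j => ((σ j ^ 2 : ℝ) : ℂ)) * Vᴴ := by
  have hd : (diagonal (fun j => (σ j : ℂ)))ᴴ = diagonal (fun j => (σ j : ℂ)) := by
    rw [diagonal_conjTranspose]; congr 1; ext j; simp
  have hdd : diagonal (fun j => (σ j : ℂ)) * diagonal (fun j => (σ j : ℂ)) =
      diagonal (fun j => ((σ j ^ 2 : ℝ) : ℂ)) := by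
    rw [diagonal_mul_diagonal]; congr 1; ext j; push_cast; ring
  rw [conjTranspose_mul, conjTranspose_mul, conjTranspose_conjTranspose, hd, ← hdd]
  calc _ = V * diagonal (fun j => (σ j : ℂ)) * (Uᴴ * U) * diagonal (fun j => (σ j : ℂ)) * Vᴴ := by
        simp only [Matrix.mul_assoc]
    _ = _ := by rw [hU]; simp only [Matrix.mul_assoc, Matrix.mul_one]

end Helpers


/-- perturbation of a non-unitary point of the oblique manifold along
prescribed perturbed singular values: there exist `C > 0` and `ε₀ > 0` such that for any
small enough `ε` and any nonnegative diagonal `Σ̃` with `tr(Σ̃²) = tr(Σ²)` and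
`‖Σ̃² − Σ²‖_F ≤ ε`, some unitary `Ṽ` makes `X̃ = U Σ̃ Ṽ^* ∈ OB(n,p)` with
`‖X̃ − X‖_F ≤ C √ε`. -/
theorem oblique_perturbation {n p : ℕ}
    (X U : Matrix (Fin n) (Fin p) ℂ) (σ : Fin p → ℝ) (V : Matrix (Fin p) (Fin p) ℂ)
    (hOB : X ∈ OBset n p) (hne : Xᴴ * X ≠ 1)
    (hU : Uᴴ * U = 1) (hσ : ∀ j, 0 ≤ σ j)
    (hV : Vᴴ * V = 1) (hV2 : V * Vᴴ = 1)
    (hX : X = U * Matrix.diagonal (fun j => (σ j : ℂ)) * Vᴴ) :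
    ∃ C > (0 : ℝ), ∃ ε₀ > (0 : ℝ), ∀ ε : ℝ, 0 < ε → ε < ε₀ →
      ∀ σ' : Fin p → ℝ, (∀ j, 0 ≤ σ' j) →
        (∑ j, σ' j ^ 2) = (∑ j, σ j ^ 2) →
        Real.sqrt (∑ j, (σ' j ^ 2 - σ j ^ 2) ^ 2) ≤ ε →
        ∃ V' : Matrix (Fin p) (Fin p) ℂ, V'ᴴ * V' = 1 ∧ V' * V'ᴴ = 1 ∧
          U * Matrix.diagonal (fun j => (σ' j : ℂ)) * V'ᴴ ∈ OBset n p ∧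
          frobNorm (U * Matrix.diagonal (fun j => (σ' j : ℂ)) * V'ᴴ - X) ≤ C * Real.sqrt ε := by
  have hdiag : ∀ j, (Xᴴ * X) j j = 1 := hOB
  have hG : (Xᴴ * X).IsHermitian := isHermitian_conjTranspose_mul_self X
  have hgram : Xᴴ * X = V * diagonal (fun j => ((σ j ^ 2 : ℝ) : ℂ)) * Vᴴ := by
    rw [hX, gram_eq hU]
  obtain ⟨k, l, hkl, hg⟩ : ∃ k l, k ≠ l ∧ (Xᴴ * X) k l ≠ 0 := by
    by_contra! hc
    refine hne (Matrix.ext fun i j => ?_)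
    rcases eq_or_ne i j with rfl | hij
    · rw [hdiag, one_apply_eq]
    · rw [hc i j hij, one_apply_ne hij]
  obtain ⟨C, hC, r₀, hr₀, h⟩ := exists_unitary_diag_eq_one hG hdiag hkl hg
  set κ := ‖V‖ + 1 with hκ
  have hκpos : 0 < κ := by positivity
  set Λ := diagonal (fun j => (σ j : ℂ)) with hΛ
  set M := ‖(1 : Matrix (Fin p) (Fin p) ℂ)‖ + C with hM
  refine ⟨‖U‖ * √p * (M * ‖V‖) + ‖U‖ * ‖Λ‖ * (C * κ * ‖V‖) + 1, by positivity,
    min ((r₀ / κ) ^ 2) ((1 / κ) ^ 2), by positivity, ?_⟩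
  intro ε hε hεlt σ' hσ' hsum hdist
  rw [lt_min_iff] at hεlt
  have hr1 : κ * √ε < r₀ := by
    rw [← lt_div_iff₀' hκpos]; exact (Real.sqrt_lt' (by positivity)).2 hεlt.1
  have hr2 : κ * √ε < 1 := by
    rw [← lt_div_iff₀' hκpos]; exact (Real.sqrt_lt' (by positivity)).2 hεlt.2
  set A := V * diagonal (fun j => ((σ' j ^ 2 : ℝ) : ℂ)) * Vᴴ with hA
  have htr : A.trace = p := by
    have hXtr : (Xᴴ * X).trace = p := by simp [trace, hdiag]
    rw [← hXtr, hgram, hA, trace_conj_eq hV2, trace_conj_eq hV2, trace_diagonal, trace_diagonal]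
    exact_mod_cast hsum
  have hAG : ‖A - Xᴴ * X‖ ≤ (κ * √ε) ^ 2 := by
    have hsub : A - Xᴴ * X = V * diagonal (fun j => ((σ' j ^ 2 - σ j ^ 2 : ℝ) : ℂ)) * Vᴴ := by
      rw [hgram, hA, ← Matrix.sub_mul, ← Matrix.mul_sub, diagonal_sub]
      simp
    calc ‖A - Xᴴ * X‖ ≤ ‖V‖ * ε * ‖V‖ := by
          rw [hsub]
          refine (norm_mul_le _ _).trans ?_
          rw [frobenius_norm_conjTranspose]
          gcongr
          refine (norm_mul_le _ _).trans ?_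
          rw [norm_diagonal_ofReal]
          gcongr
      _ ≤ κ * ε * κ := by gcongr <;> simp [hκ]
      _ = _ := by rw [mul_pow, Real.sq_sqrt hε.le]; ring
  have hAh : A.IsHermitian := isHermitian_mul_mul_conjTranspose V (by
    rw [IsHermitian, diagonal_conjTranspose]; congr 1; ext j; simp)
  obtain ⟨W, hW, hW1, hWd⟩ := h A hAh htr (κ * √ε) (by positivity) hr1 hAG
  have hunit : W * V * (W * V)ᴴ = 1 := by
    rw [conjTranspose_mul, mul_assoc, ← mul_assoc V, hV2, one_mul, hW]
  have hWn : ‖W‖ ≤ M := by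
    calc ‖W‖ = ‖1 + (W - 1)‖ := by rw [add_sub_cancel]
      _ ≤ ‖(1 : Matrix (Fin p) (Fin p) ℂ)‖ + ‖W - 1‖ := norm_add_le _ _
      _ ≤ M := by rw [hM]; gcongr; exact hW1.trans (mul_le_of_le_one_right hC hr2.le)
  refine ⟨W * V, mul_eq_one_comm.1 hunit, hunit, ?_, ?_⟩
  · intro j
    rw [gram_eq hU, ← hWd j, hA]
    simp only [conjTranspose_mul, mul_assoc]
  · rw [frobNorm_eq_norm]
    have hdiff : ‖diagonal (fun j => ((σ' j - σ j : ℝ) : ℂ))‖ ≤ √p * √ε := by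
      rw [norm_diagonal_ofReal, ← Real.sqrt_mul (Nat.cast_nonneg p)]
      exact Real.sqrt_le_sqrt (sum_sub_sq_le hσ hσ' hdist)
    have hsplit : U * diagonal (fun j => (σ' j : ℂ)) * (W * V)ᴴ - X =
        U * diagonal (fun j => ((σ' j - σ j : ℝ) : ℂ)) * (W * V)ᴴ + U * Λ * ((W - 1) * V)ᴴ := by
      have hd : diagonal (fun j => (σ' j : ℂ)) =
          diagonal (fun j => ((σ' j - σ j : ℝ) : ℂ)) + Λ := by
        rw [hΛ, diagonal_add]; simp
      rw [hX, hd, Matrix.sub_mul, Matrix.one_mul, conjTranspose_sub, Matrix.mul_sub,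
        Matrix.mul_add, Matrix.add_mul]
      abel
    calc _ ≤ ‖U‖ * (√p * √ε) * (M * ‖V‖) + ‖U‖ * ‖Λ‖ * (C * (κ * √ε) * ‖V‖) := by
          rw [hsplit]
          refine (norm_add_le _ _).trans (add_le_add ?_ ?_)
          · refine (frobenius_norm_mul _ _).trans ?_
            rw [frobenius_norm_conjTranspose]
            gcongr
            · exact (frobenius_norm_mul _ _).trans (by gcongr)
            · exact (frobenius_norm_mul _ _).trans (by gcongr)
          · refine (frobenius_norm_mul _ _).trans ?_
            rw [frobenius_norm_conjTranspose]
            gcongr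
            · exact frobenius_norm_mul _ _
            · exact (frobenius_norm_mul _ _).trans (by gcongr)
      _ ≤ _ := by linarith [Real.sqrt_nonneg ε]
end
end
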